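/- Let κ > 1 be real and set α = 1/κ ∈ (0,1). Put β = α·Γ(α+1)·ζ(α+1). Then, as n → ∞, q_κ(n) ~ c · n^{−(α+2)/(2(1+α))} · exp( (1+κ)·((1−2^{−α})β)^{1/(1+α)}·n^{1/(1+κ)} ), where c = ((1−2^{−α})β)^{1/(2(1+α))} / (2√(π(1+α))). -/

import Mathlib

open Filter Topology Real

/-- The Piatetski-Shapiro part: `⌊ℓ^κ⌋`. -/
noncomputable def psPart (κ : ℝ) (ℓ : ℕ) : ℕ := ⌊(ℓ : ℝ) ^ κ⌋₊

/-- `q_κ(n)`: number of partitions of `n` into distinct parts from `(⌊ℓ^κ⌋)_{ℓ ≥ 1}`,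
i.e. each index used at most once. -/
noncomputable def qk (κ : ℝ) (n : ℕ) : ℕ :=
  Nat.card {r : ℕ →₀ ℕ // (∀ ℓ, r ℓ ≤ 1) ∧ (r.sum fun ℓ j => j * psPart κ (ℓ + 1)) = n}

/-- Riemann zeta at a real argument (real-valued there). -/
noncomputable def realZeta (x : ℝ) : ℝ := (riemannZeta (x : ℂ)).re

theorem fwdDiff_iter_mem_Icc_of_deriv (k : ℕ) : ∀ (G : ℕ → ℝ → ℝ) (a b c C h : ℝ), 0 ≤ h →
    (∀ i < k, ∀ t ∈ Set.Icc a b, HasDerivAt (G i) (G (i + 1) t) t) →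
    (∀ t ∈ Set.Icc a b, G k t ∈ Set.Icc c C) →
    ∀ s, a ≤ s → s + k * h ≤ b →
      (fwdDiff h)^[k] (G 0) s ∈ Set.Icc (h ^ k * c) (h ^ k * C) := by
  induction k with
  | zero =>
    intro G a b c C h _ _ hG s has hsb
    simpa using hG s ⟨has, by simpa using hsb⟩
  | succ k ih =>
    intro G a b c C h hh hd hG s has hsb
    push_cast at hsb
    have key := ih (fun i => fwdDiff h (G i)) a (b - h) (h * c) (h * C) h hh
      (fun i hi t ht => by
        have h1 := hd i (by omega) t ⟨ht.1, by linarith [ht.2]⟩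
        have h2 := hd i (by omega) (t + h) ⟨by linarith [ht.1], by linarith [ht.2]⟩
        have h3 := (h2.comp_add_const t h).sub h1
        exact h3)
      (fun t ht => by
        rcases hh.eq_or_lt with h0 | h0
        · subst h0; simp [fwdDiff]
        have hsub : Set.Icc t (t + h) ⊆ Set.Icc a b :=
          Set.Icc_subset_Icc ht.1 (by linarith [ht.2])
        obtain ⟨x, hx, hx'⟩ := exists_hasDerivAt_eq_slope (G k) (G (k + 1))
          (show t < t + h by linarith)
          (fun y hy => (hd k (by omega) y (hsub hy)).continuousAt.continuousWithinAt)
          (fun y hy => hd k (by omega) y (hsub ⟨hy.1.le, hy.2.le⟩))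
        have hb := hG x (hsub ⟨hx.1.le, hx.2.le⟩)
        have : fwdDiff h (G k) t = h * G (k + 1) x := by
          rw [hx', fwdDiff, add_sub_cancel_left]; field_simp
        rw [this]
        exact ⟨by gcongr; exact hb.1, by gcongr; exact hb.2⟩)
      s has (by linarith)
    rw [Function.iterate_succ_apply]
    simpa [pow_succ, mul_assoc] using key

theorem exists_int_abs_fwdDiff_iter_sub_le (F : ℝ → ℝ) (h ε : ℝ) (k : ℕ) : ∀ s : ℝ,
    (∀ i ≤ k, ∃ z : ℤ, |F (s + i * h) - z| ≤ ε) →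
    ∃ z : ℤ, |(fwdDiff h)^[k] F s - z| ≤ 2 ^ k * ε := by
  induction k with
  | zero => intro s hs; simpa using hs 0 le_rfl
  | succ k ih =>
    intro s hs
    obtain ⟨z₁, h₁⟩ := ih s fun i hi => hs i (by omega)
    obtain ⟨z₂, h₂⟩ := ih (s + h) fun i hi => by
      obtain ⟨z, hz⟩ := hs (i + 1) (by omega)
      refine ⟨z, ?_⟩
      push_cast at hz
      rwa [show s + h + i * h = s + (i + 1) * h by ring]
    refine ⟨z₂ - z₁, ?_⟩
    rw [Function.iterate_succ_apply', fwdDiff, pow_succ]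
    push_cast
    calc _ = |((fwdDiff h)^[k] F (s + h) - z₂) - ((fwdDiff h)^[k] F s - z₁)| := by ring_nf
      _ ≤ _ := abs_sub _ _
      _ ≤ _ := by linarith

theorem exists_int_sub_mem_Ico_of_steps (g : ℕ → ℝ) (L : ℕ) (l e : ℝ) (he : 0 < e)
    (hL : 1 ≤ l * L) (hg : ∀ i < L, g (i + 1) - g i ∈ Set.Icc l e) (t : ℝ) :
    ∃ i ≤ L, ∃ z : ℤ, g i - t - z ∈ Set.Ico 0 e := by
  classical
  have hgrow : ∀ m ≤ L, g 0 + l * m ≤ g m := by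
    intro m
    induction m with
    | zero => simp
    | succ m ih =>
      intro hm
      have := (hg m (by omega)).1
      have := ih (by omega)
      push_cast; linarith
  set z := ⌈g 0 - t⌉
  have hz1 : g 0 - t ≤ z := Int.le_ceil _
  have hz2 : (z : ℝ) < g 0 - t + 1 := Int.ceil_lt_add_one _
  have hex : ∃ i, t + z ≤ g i := ⟨L, by linarith [hgrow L le_rfl]⟩
  have hle : Nat.find hex ≤ L := Nat.find_min' hex (by linarith [hgrow L le_rfl])
  refine ⟨Nat.find hex, hle, z, by linarith [Nat.find_spec hex], ?_⟩
  rcases Nat.eq_zero_or_eq_succ_pred (Nat.find hex) with h0 | h0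
  · rw [h0]; linarith
  · have h1 := Nat.find_min hex (m := (Nat.find hex).pred) (by omega)
    have h2 := (hg (Nat.find hex).pred (by omega)).2
    rw [h0]
    push Not at h1
    simp only [Nat.succ_eq_add_one] at *
    linarith

theorem fwdDiff_iter_choose_self (m : ℕ) :
    (fwdDiff 1)^[m] (fun x : ℕ => (x.choose m : ℝ)) = fun _ => 1 := by
  induction m with
  | zero => simp
  | succ m ih =>
    rw [Function.iterate_succ_apply, ← ih]
    congr 1
    ext x
    simp [fwdDiff, Nat.choose_succ_succ]

theorem exists_int_sub_mem_Ico_of_fwdDiff_iter (k : ℕ) : ∀ ε : ℝ, 0 < ε → ∃ l₀ > 0, ∃ K > 0,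
    ∀ (g : ℕ → ℝ) (l : ℝ) (L : ℕ), 0 < l → l ≤ l₀ → K ≤ l * L →
    (∀ i < L, (fwdDiff 1)^[k + 1] g i ∈ Set.Icc l (4 * l)) →
    ∀ t : ℝ, ∃ i ≤ L + k, ∃ z : ℤ, g i - t - z ∈ Set.Ico 0 ε := by
  induction k with
  | zero =>
    intro ε hε
    refine ⟨ε / 4, by positivity, 1, one_pos, fun g l L hl hl0 hK hg t => ?_⟩
    refine exists_int_sub_mem_Ico_of_steps g L l ε hε hK (fun i hi => ?_) t
    have := hg i hi
    simp only [zero_add, Function.iterate_one, fwdDiff] at this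
    exact ⟨this.1, by linarith [this.2]⟩
  | succ k ih =>
    intro ε hε
    obtain ⟨τ, hτ, K, hK, H⟩ := ih ε hε
    refine ⟨τ ^ 2 / (4 * (K + τ)), by positivity, 2 + τ ^ 2 / (4 * (K + τ)) + τ, by positivity,
      fun g l L hl hl0 hKl hg t => ?_⟩
    set u := (fwdDiff 1)^[k + 1] g with hu
    have hstep : ∀ i < L, u (i + 1) - u i ∈ Set.Icc l (4 * l) := by
      intro i hi
      have := hg i hi
      rwa [Function.iterate_succ_apply'] at this
    set L₁ := ⌈1 / l⌉₊
    have hL1 : 1 / l ≤ L₁ := Nat.le_ceil _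
    have hL1' : (L₁ : ℝ) < 1 / l + 1 := Nat.ceil_lt_add_one (by positivity)
    set J := ⌊τ / (4 * l)⌋₊
    have hJ : (J : ℝ) ≤ τ / (4 * l) := Nat.floor_le (by positivity)
    have hJ' : τ / (4 * l) < J + 1 := Nat.lt_floor_add_one _
    have e1 : l * (1 / l) = 1 := by field_simp
    have e2 : l * (τ / (4 * l)) = τ / 4 := by field_simp
    have hfit : L₁ + J ≤ L := by
      have : l * (L₁ + J : ℝ) ≤ l * L := by
        have h1 : l * (L₁ : ℝ) ≤ l * (1 / l + 1) := by gcongr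
        have h2 : l * (J : ℝ) ≤ l * (τ / (4 * l)) := by gcongr
        nlinarith
      exact_mod_cast le_of_mul_le_mul_left this hl
    obtain ⟨i₀, hi₀, z, hz⟩ := exists_int_sub_mem_Ico_of_steps u L₁ l (4 * l) (by positivity)
      (by rw [div_le_iff₀ hl] at hL1; linarith) (fun i hi => hstep i (by omega)) τ
    have hgrow : ∀ j ≤ J, u (i₀ + j) ∈ Set.Icc (u i₀) (u i₀ + 4 * l * j) := by
      intro j
      induction j with
      | zero => simp
      | succ j ihj =>
        intro hj
        have h1 := ihj (by omega)
        have h2 := hstep (i₀ + j) (by omega)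
        rw [add_assoc] at h2
        push_cast
        exact ⟨by linarith [h1.1, h2.1], by linarith [h1.2, h2.2]⟩
    obtain ⟨i, hi, z', hz'⟩ := H (fun j => g (j + i₀) - z * (j.choose (k + 1) : ℝ)) τ J hτ le_rfl
      (by
        have h1 : l * (4 * (K + τ)) ≤ τ ^ 2 := by rwa [le_div_iff₀ (by positivity)] at hl0
        have h2 : τ < 4 * l * (J + 1) := by
          rw [div_lt_iff₀ (by positivity)] at hJ'; linarith
        have h3 : τ ^ 2 ≤ 4 * l * (J * τ + τ) := by nlinarith
        have h4 : 4 * l * (K + τ) ≤ 4 * l * (J * τ + τ) := by linarith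
        have := le_of_mul_le_mul_left h4 (by positivity)
        linarith)
      (fun j hj => by
        have e : (fwdDiff 1)^[k + 1] (fun j => g (j + i₀) - z * (j.choose (k + 1) : ℝ)) j
            = u (i₀ + j) - z := by
          have h1 : (fun j => g (j + i₀) - z * (j.choose (k + 1) : ℝ))
              = (fun j => g (j + i₀)) + (-(z : ℝ)) • (fun j : ℕ => (j.choose (k + 1) : ℝ)) := by
            ext j; simp; ring
          rw [h1, fwdDiff_iter_add, fwdDiff_iter_const_smul, fwdDiff_iter_choose_self]
          simp only [Pi.add_apply, Pi.smul_apply, smul_eq_mul]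
          rw [fwdDiff_iter_comp_add, hu, add_comm j]
          ring
        rw [e]
        have h1 := hgrow j hj.le
        have h2 : 4 * l * ((j : ℝ) + 1) ≤ τ := by
          have : (j : ℝ) + 1 ≤ J := by exact_mod_cast hj
          have : (j : ℝ) + 1 ≤ τ / (4 * l) := by linarith
          rw [le_div_iff₀ (by positivity)] at this
          linarith
        exact ⟨by linarith [h1.1, hz.1], by linarith [h1.2, hz.2]⟩) t
    refine ⟨i + i₀, by omega, z' + z * (i.choose (k + 1) : ℕ), ?_⟩
    convert hz' using 1
    push_cast; ring

theorem psPart_le_rpow (κ : ℝ) (l : ℕ) : (psPart κ l : ℝ) ≤ (l : ℝ) ^ κ :=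
  Nat.floor_le (by positivity)

theorem rpow_lt_psPart_add_one (κ : ℝ) (l : ℕ) : (l : ℝ) ^ κ < psPart κ l + 1 :=
  Nat.lt_floor_add_one _

/-- The coefficient `κ (κ - 1) ⋯ (κ - k + 1)` of the `k`-th derivative of `t ^ κ`. -/
noncomputable def fallingProd (κ : ℝ) (k : ℕ) : ℝ := ∏ j ∈ Finset.range k, (κ - j)

theorem fallingProd_pos {κ : ℝ} {k : ℕ} (hk : (k : ℝ) - 1 < κ) : 0 < fallingProd κ k := by
  refine Finset.prod_pos fun j hj => ?_
  have : (j : ℝ) + 1 ≤ k := by exact_mod_cast Finset.mem_range.mp hj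
  linarith

theorem fallingProd_succ (κ : ℝ) (k : ℕ) : fallingProd κ (k + 1) = fallingProd κ k * (κ - k) :=
  Finset.prod_range_succ _ _

theorem fwdDiff_iter_rpow_mem_Icc {κ : ℝ} {k : ℕ} (hk : (k : ℝ) - 1 < κ) (hk' : κ ≤ k)
    {a b h s : ℝ} (ha : 0 < a) (hh : 0 ≤ h) (has : a ≤ s) (hsb : s + k * h ≤ b) :
    (fwdDiff h)^[k] (fun t : ℝ => t ^ κ) s ∈
      Set.Icc (h ^ k * (fallingProd κ k * b ^ (κ - k)))
        (h ^ k * (fallingProd κ k * a ^ (κ - k))) := by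
  have h1 := fwdDiff_iter_mem_Icc_of_deriv k (fun i t => fallingProd κ i * t ^ (κ - i)) a b
    (fallingProd κ k * b ^ (κ - k)) (fallingProd κ k * a ^ (κ - k)) h hh
    (fun i _ t ht => by
      have ht0 : t ≠ 0 := by linarith [ht.1]
      refine ((Real.hasDerivAt_rpow_const (p := κ - i) (Or.inl ht0)).const_mul
        (fallingProd κ i)).congr_deriv ?_
      rw [fallingProd_succ]
      push_cast
      rw [mul_assoc, sub_sub])
    (fun t ht => by
      have hc := fallingProd_pos hk
      have ht0 : 0 < t := by linarith [ht.1]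
      exact ⟨by gcongr ?_ * ?_; exact Real.rpow_le_rpow_of_nonpos ht0 ht.2 (by linarith),
        by gcongr ?_ * ?_; exact Real.rpow_le_rpow_of_nonpos ha ht.1 (by linarith)⟩)
    s has hsb
  simpa [fallingProd] using h1

theorem half_rpow_le {κ : ℝ} {k : ℕ} (hk : (k : ℝ) - 1 < κ) {N : ℝ} (hN : 0 < N) :
    (N / 2) ^ (κ - k) ≤ 4 * (2 * N) ^ (κ - k) := by
  have e : (2 * N) = 4 * (N / 2) := by ring
  rw [e, Real.mul_rpow (by norm_num) (by positivity), ← mul_assoc]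
  have : (1 : ℝ) ≤ 4 * 4 ^ (κ - k) := by
    have : (4 : ℝ) ^ (0 : ℝ) ≤ 4 ^ (1 + (κ - k)) :=
      Real.rpow_le_rpow_of_exponent_le (by norm_num) (by linarith)
    rwa [Real.rpow_add (by norm_num), Real.rpow_zero, Real.rpow_one] at this
  exact le_mul_of_one_le_left (by positivity) this

theorem mul_fwdDiff_rpow_le_of_near_int {κ : ℝ} {k : ℕ} (hk : (k : ℝ) - 1 < κ) (hk' : κ ≤ k)
    {N : ℝ} (hN : 2 ≤ N) {m H : ℕ} (hm : N / 2 ≤ m) (hmH : (m : ℝ) + k * H ≤ 2 * N) {Y η : ℝ}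
    (hη : 2 ^ (2 * k + 2) * η ≤ 1 / 4) (hY : |Y| * fallingProd κ k ≤ 1 / 4)
    (hz : ∀ l : ℕ, m ≤ l → l ≤ m + k * H → ∃ z : ℤ, |Y * (l : ℝ) ^ κ - z| ≤ η) (hH : 1 ≤ H) :
    |Y| * ((H : ℝ) ^ k * (fallingProd κ k * (2 * N) ^ (κ - k))) ≤ 2 ^ k * η := by
  have hc := fallingProd_pos hk
  have hη0 : 0 ≤ η := by
    obtain ⟨z, h⟩ := hz m le_rfl (by omega)
    exact (abs_nonneg _).trans h
  set D : ℕ → ℝ := fun h => (fwdDiff (h : ℝ))^[k] (fun t : ℝ => t ^ κ) m with hD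
  have hDb : ∀ h ≤ H, D h ∈ Set.Icc ((h : ℝ) ^ k * (fallingProd κ k * (2 * N) ^ (κ - k)))
        ((h : ℝ) ^ k * (fallingProd κ k * (N / 2) ^ (κ - k))) := fun h hh => by
    have : (h : ℝ) ≤ H := by exact_mod_cast hh
    exact fwdDiff_iter_rpow_mem_Icc hk hk' (by positivity) (by positivity) hm
      (le_trans (by gcongr) hmH)
  have hD0 : ∀ h ≤ H, 0 ≤ D h := fun h hh => le_trans (by positivity) (hDb h hh).1
  have hnear : ∀ h ≤ H, |Y| * D h ≤ 1 / 4 → |Y| * D h ≤ 2 ^ k * η := by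
    intro h hh hs
    obtain ⟨z, hz⟩ := exists_int_abs_fwdDiff_iter_sub_le (fun t => Y * t ^ κ) h η k m
      fun i hi => by
        obtain ⟨z, hz⟩ := hz (m + i * h) (by omega)
          (by have := Nat.mul_le_mul hi hh; omega)
        exact ⟨z, by push_cast at hz; exact hz⟩
    have e : (fwdDiff (h : ℝ))^[k] (fun t => Y * t ^ κ) m = Y * D h := by
      have : (fun t : ℝ => Y * t ^ κ) = Y • (fun t : ℝ => t ^ κ) := by ext; simp
      rw [this, fwdDiff_iter_const_smul]; simp [hD]
    rw [e] at hz
    have habs : |Y * D h| = |Y| * D h := by rw [abs_mul, abs_of_nonneg (hD0 h hh)]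
    have hk2 : 2 ^ k * η ≤ 1 / 4 := by
      refine le_trans ?_ hη
      gcongr
      · norm_num
      · omega
    have hz0 : z = 0 := by
      have : |(z : ℝ)| < 1 := by
        have := abs_sub_abs_le_abs_sub (z : ℝ) (Y * D h)
        rw [abs_sub_comm] at hz
        linarith
      exact_mod_cast Int.abs_lt_one_iff.mp (by exact_mod_cast this)
    rw [hz0] at hz
    rw [← habs]; simpa using hz
  have hall : ∀ h, 1 ≤ h → h ≤ H → |Y| * D h ≤ 2 ^ k * η := by
    intro h h1
    induction h, h1 using Nat.le_induction with
    | base =>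
      intro hh
      refine hnear 1 hh ?_
      have h2 := (hDb 1 hh).2
      have h3 : (N / 2) ^ (κ - k) ≤ 1 :=
        Real.rpow_le_one_of_one_le_of_nonpos (by linarith) (by linarith)
      calc |Y| * D 1 ≤ |Y| * ((1 : ℕ) ^ k * (fallingProd κ k * 1)) := by
            gcongr; exact h2.trans (by gcongr)
        _ ≤ _ := by simpa using hY
    | succ h h1 ih =>
      intro hh
      have ih := ih (by omega)
      refine hnear _ hh ?_
      have h2 := (hDb (h + 1) hh).2
      have h3 := (hDb h (by omega)).1
      have hN0 : 0 < N := by linarith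
      have h4 := half_rpow_le hk hN0
      have h5 : ((h + 1 : ℕ) : ℝ) ≤ 2 * h := by push_cast; have : (1 : ℝ) ≤ h := by exact_mod_cast h1
                                                linarith
      calc |Y| * D (h + 1)
          ≤ |Y| * ((2 * h : ℝ) ^ k * (fallingProd κ k * (4 * (2 * N) ^ (κ - k)))) := by
            gcongr; exact h2.trans (by gcongr)
        _ = 2 ^ k * 4 * (|Y| * ((h : ℝ) ^ k * (fallingProd κ k * (2 * N) ^ (κ - k)))) := by
            rw [mul_pow]; ring
        _ ≤ 2 ^ k * 4 * (|Y| * D h) := by gcongr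
        _ ≤ 2 ^ k * 4 * (2 ^ k * η) := by gcongr
        _ = 2 ^ (2 * k + 2) * η := by ring
        _ ≤ _ := hη
  exact le_trans (by gcongr; exact (hDb H le_rfl).1) (hall H hH le_rfl)

theorem fwdDiff_iter_comp_natCast (F : ℝ → ℝ) (k : ℕ) : ∀ (s : ℝ) (i : ℕ),
    (fwdDiff 1)^[k] (fun i : ℕ => F (s + i)) i = (fwdDiff (1 : ℝ))^[k] F (s + i) := by
  induction k with
  | zero => simp
  | succ k ih =>
    intro s i
    simp only [Function.iterate_succ_apply', fwdDiff, ih]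
    push_cast
    ring_nf

theorem not_modEq_of_int_exponent {k q m : ℕ} (hk : k ≠ 0) (hq : 2 ≤ q) :
    ∃ l, m ≤ l ∧ l ≤ m + 2 * q ∧ ¬ l ^ k ≡ m ^ k [MOD q] := by
  by_contra! H
  have h1 := Nat.div_add_mod m q
  have h2 := Nat.mod_lt m (show q > 0 by omega)
  have e : q * (m / q + 1) = q * (m / q) + q := by ring
  have ha := H (q * (m / q + 1)) (by omega) (by omega)
  have hb := H (q * (m / q + 1) + 1) (by omega) (by omega)
  have hc := hb.trans ha.symm
  have hd : q * (m / q + 1) ≡ 0 [MOD q] := (Nat.modEq_zero_iff_dvd).2 ⟨_, rfl⟩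
  have he : (1 : ℕ) ≡ 0 [MOD q] := by
    have h3 := (hd.add_right 1).pow k
    have h4 := hd.pow k
    simp only [zero_add, one_pow, ne_eq, hk, not_false_eq_true, zero_pow] at h3 h4
    exact h3.symm.trans (hc.trans h4)
  have := Nat.le_of_dvd one_pos ((Nat.modEq_zero_iff_dvd).1 he)
  omega

theorem eventually_exists_not_modEq {κ : ℝ} {k : ℕ} (hk2 : 1 ≤ k) (hk : (k : ℝ) - 1 < κ)
    (hk' : κ ≤ k) {d : ℝ} (hd : 0 < d) (hd' : d < κ - k + 1) {Q : ℕ} (hQ : 1 ≤ Q) :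
    ∀ᶠ N : ℕ in atTop, ∀ m : ℕ, (N : ℝ) / 2 ≤ m → m ≤ N → ∀ q, 2 ≤ q → q ≤ Q →
      ∃ l, m ≤ l ∧ (l : ℝ) ≤ m + (N : ℝ) ^ (1 - d) ∧ ¬ psPart κ l ≡ psPart κ m [MOD q] := by
  have hd1 : d < 1 := by linarith
  have hpow : ∀ e : ℝ, 0 < e → Tendsto (fun N : ℕ => (N : ℝ) ^ e) atTop atTop := fun e he =>
    (tendsto_rpow_atTop he).comp tendsto_natCast_atTop_atTop
  rcases hk'.eq_or_lt with rfl | hlt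
  · filter_upwards [(hpow (1 - d) (by linarith)).eventually_ge_atTop (2 * Q : ℝ)]
      with N hN m _ _ q hq hqQ
    obtain ⟨l, h1, h2, h3⟩ := not_modEq_of_int_exponent (k := k) (m := m) (by omega) hq
    refine ⟨l, h1, ?_, ?_⟩
    · have : (l : ℝ) ≤ m + 2 * q := by exact_mod_cast h2
      have : (q : ℝ) ≤ Q := by exact_mod_cast hqQ
      linarith
    · have e : ∀ l : ℕ, psPart k l = l ^ k := fun l => by
        rw [psPart, Real.rpow_natCast, ← Nat.cast_pow, Nat.floor_natCast]
      rwa [e, e]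
  · have hc := fallingProd_pos hk
    obtain ⟨j, rfl⟩ : ∃ j, k = j + 1 := ⟨k - 1, by omega⟩
    have hQ0 : (0 : ℝ) < Q := by exact_mod_cast hQ
    obtain ⟨l₀, hl₀, K, hK, H⟩ := exists_int_sub_mem_Ico_of_fwdDiff_iter j (1 / (Q : ℝ)) (by positivity)
    set c := fallingProd κ (j + 1)
    set e : ℝ := κ - (j + 1 : ℕ) with he
    have hlam : Tendsto (fun N : ℕ => c * (2 * (N : ℝ)) ^ e) atTop (𝓝 0) := by
      have h1 : Tendsto (fun N : ℕ => (2 * (N : ℝ)) ^ e) atTop (𝓝 0) := by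
        have := (tendsto_rpow_neg_atTop (y := -e) (by linarith)).comp
          (tendsto_natCast_atTop_atTop.const_mul_atTop (show (0 : ℝ) < 2 by norm_num))
        simpa [Function.comp_def] using this
      simpa using h1.const_mul c
    have hbig : Tendsto (fun N : ℕ => c * 2 ^ e * (N : ℝ) ^ (e + 1 - d)
        - (j + 2) * (c * (2 * (N : ℝ)) ^ e)) atTop atTop := by
      refine Tendsto.atTop_add ((hpow (e + 1 - d) (by linarith)).const_mul_atTop (by positivity))
        (C := 0) ?_
      simpa using (hlam.const_mul (j + 2 : ℝ)).neg
    filter_upwards [hlam.eventually_le_const hl₀, hbig.eventually_ge_atTop (K * Q),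
      eventually_ge_atTop 2, (hpow (1 - d) (by linarith)).eventually_ge_atTop (j + 2 : ℝ)] with N hN1 hN2 hN3 hN4 m hm hmN q hq hqQ
    have hN0 : (0 : ℝ) < N := by positivity
    have hq0 : (0 : ℝ) < q := by positivity
    have hqQ' : (q : ℝ) ≤ Q := by exact_mod_cast hqQ
    set L := ⌊(N : ℝ) ^ (1 - d)⌋₊ - (j + 1) with hL
    have hfl : (⌊(N : ℝ) ^ (1 - d)⌋₊ : ℝ) ≤ (N : ℝ) ^ (1 - d) := Nat.floor_le (by positivity)
    have hfl' : (N : ℝ) ^ (1 - d) < ⌊(N : ℝ) ^ (1 - d)⌋₊ + 1 := Nat.lt_floor_add_one _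
    have hj : j + 1 ≤ ⌊(N : ℝ) ^ (1 - d)⌋₊ := Nat.le_floor (by push_cast; linarith)
    have hLr : (L : ℝ) = ⌊(N : ℝ) ^ (1 - d)⌋₊ - (j + 1) := by rw [hL, Nat.cast_sub hj]; push_cast; ring
    have hle1 : (N : ℝ) ^ (1 - d) ≤ N := by
      calc (N : ℝ) ^ (1 - d) ≤ (N : ℝ) ^ (1 : ℝ) :=
            Real.rpow_le_rpow_of_exponent_le (by exact_mod_cast (by omega : 1 ≤ N)) (by linarith)
        _ = N := Real.rpow_one _
    have hmN' : (m : ℝ) ≤ N := by exact_mod_cast hmN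
    set l := c * (2 * (N : ℝ)) ^ e / q with hl
    have hl0 : 0 < l := by positivity
    obtain ⟨i, hi, z, hz⟩ := H (fun i => ((m : ℝ) + i) ^ κ / q) l L hl0
      ((div_le_self (by positivity) (by exact_mod_cast (by omega : 1 ≤ q))).trans hN1)
      (by
        have h1 : (N : ℝ) ^ (1 - d) - (j + 2) ≤ L := by rw [hLr]; linarith
        have h2 : c * 2 ^ e * (N : ℝ) ^ (e + 1 - d) = c * (2 * (N : ℝ)) ^ e * N ^ (1 - d) := by
          rw [Real.mul_rpow (by norm_num) hN0.le, show e + 1 - d = e + (1 - d) by ring,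
            Real.rpow_add hN0]; ring
        rw [h2] at hN2
        have h3 : K * q ≤ c * (2 * (N : ℝ)) ^ e * L := by
          calc K * q ≤ K * Q := by gcongr
            _ ≤ c * (2 * (N : ℝ)) ^ e * ((N : ℝ) ^ (1 - d) - (j + 2)) := by linarith
            _ ≤ _ := by gcongr
        rw [hl, div_mul_eq_mul_div, le_div_iff₀ hq0]; exact h3)
      (fun i hi => by
        have hi' : (i : ℝ) + 1 ≤ L := by exact_mod_cast hi
        have e1 : (fun i : ℕ => ((m : ℝ) + i) ^ κ / q)
            = (q : ℝ)⁻¹ • (fun i : ℕ => (fun t : ℝ => t ^ κ) (m + i)) := by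
          ext; simp [div_eq_inv_mul]
        rw [e1, fwdDiff_iter_const_smul, Pi.smul_apply,
          fwdDiff_iter_comp_natCast (fun t : ℝ => t ^ κ), smul_eq_mul]
        have h1 := fwdDiff_iter_rpow_mem_Icc hk hk' (a := N / 2) (b := 2 * N) (h := 1)
          (s := m + i) (by positivity) zero_le_one (by linarith [(Nat.cast_nonneg i : (0 : ℝ) ≤ i)])
          (by push_cast; linarith)
        simp only [one_pow, one_mul] at h1
        have h4 := half_rpow_le hk hN0
        rw [hl, div_eq_inv_mul]
        refine ⟨by gcongr; exact h1.1, ?_⟩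
        calc (q : ℝ)⁻¹ * _ ≤ (q : ℝ)⁻¹ * (c * (4 * (2 * N) ^ e)) := by
              gcongr; exact h1.2.trans (by gcongr)
          _ = _ := by ring)
      ((psPart κ m + 1) / q)
    refine ⟨m + i, by omega, ?_, ?_⟩
    · have h1 : (i : ℝ) ≤ L + j := by exact_mod_cast hi
      push_cast; linarith
    · have h1 : (psPart κ (m + i) : ℤ) = psPart κ m + 1 + q * z := by
        have h0 := psPart_le_rpow κ (m + i)
        have h0' := rpow_lt_psPart_add_one κ (m + i)
        have e2 : ((m + i : ℕ) : ℝ) ^ κ - (psPart κ m + 1) - q * z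
            = q * (((m : ℝ) + i) ^ κ / q - (psPart κ m + 1) / q - z) := by
          push_cast; field_simp
        have h2 : 0 ≤ ((m + i : ℕ) : ℝ) ^ κ - (psPart κ m + 1) - q * z := by
          rw [e2]; exact mul_nonneg hq0.le hz.1
        have h3 : ((m + i : ℕ) : ℝ) ^ κ - (psPart κ m + 1) - q * z < 1 := by
          rw [e2]
          calc _ < (q : ℝ) * (1 / Q) := by gcongr; exact hz.2
            _ ≤ (Q : ℝ) * (1 / Q) := by gcongr
            _ = 1 := by field_simp
        have h4 : ((psPart κ (m + i) : ℤ) : ℝ) < ((psPart κ m + 1 + q * z + 1 : ℤ) : ℝ) := by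
          push_cast; linarith
        have h5 : ((psPart κ m + 1 + q * z : ℤ) : ℝ) < ((psPart κ (m + i) + 1 : ℤ) : ℝ) := by
          push_cast; linarith
        have h4 : (psPart κ (m + i) : ℤ) < (psPart κ m + 1 + q * z + 1 : ℤ) := by exact_mod_cast h4
        have h5 : (psPart κ m + 1 + q * z : ℤ) < (psPart κ (m + i) + 1 : ℤ) := by exact_mod_cast h5
        omega
      intro h
      have h2 := (Nat.modEq_iff_dvd.mp h)
      rw [h1] at h2
      have h3 : (q : ℤ) ∣ 1 := by
        have : (1 : ℤ) = -((psPart κ m : ℤ) - (psPart κ m + 1 + q * z)) - q * z := by ring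
        rw [this]
        exact dvd_sub (dvd_neg.mpr h2) (dvd_mul_right _ _)
      have := Int.le_of_dvd one_pos h3
      omega

theorem tendsto_natCast_rpow_atTop {e : ℝ} (he : 0 < e) :
    Tendsto (fun N : ℕ => (N : ℝ) ^ e) atTop atTop :=
  (tendsto_rpow_atTop he).comp tendsto_natCast_atTop_atTop

theorem rpow_sub_rpow_le {κ a b : ℝ} (hκ : 1 < κ) (ha : 0 < a) (hab : a ≤ b) :
    b ^ κ - a ^ κ ≤ κ * b ^ (κ - 1) * (b - a) := by
  rcases hab.eq_or_lt with rfl | hab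
  · simp
  obtain ⟨x, hx, hx'⟩ := exists_hasDerivAt_eq_slope (fun t : ℝ => t ^ κ)
    (fun t => κ * t ^ (κ - 1)) hab
    (fun y hy => (Real.continuousAt_rpow_const y κ
      (Or.inl (by linarith [hy.1]))).continuousWithinAt)
    (fun y hy => Real.hasDerivAt_rpow_const (Or.inl (by linarith [hy.1])))
  rw [eq_div_iff (by linarith)] at hx'
  rw [← hx']
  have : 0 < x := ha.trans hx.1
  have : x ^ (κ - 1) ≤ b ^ (κ - 1) := Real.rpow_le_rpow this.le hx.2.le (by linarith)
  gcongr

theorem dvd_of_abs_mul_sub_lt {p a : ℤ} {q : ℕ} {z : ℤ} {y : ℝ} (hcop : p.natAbs.Coprime q)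
    (hq : 0 < q) (h : |((p : ℝ) / q + y) * a - z| + |y * a| < 1 / q) : (q : ℤ) ∣ a := by
  have hq0 : (0 : ℝ) < q := by exact_mod_cast hq
  have h1 : |(p : ℝ) / q * a - z| < 1 / q := by
    refine lt_of_le_of_lt ?_ h
    calc |(p : ℝ) / q * a - z| = |(((p : ℝ) / q + y) * a - z) - y * a| := by ring_nf
      _ ≤ _ := abs_sub _ _
  have h2 : |((p * a - q * z : ℤ) : ℝ)| < 1 := by
    have : ((p * a - q * z : ℤ) : ℝ) = q * ((p : ℝ) / q * a - z) := by
      push_cast; field_simp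
    rw [this, abs_mul, abs_of_pos hq0]
    calc _ < (q : ℝ) * (1 / q) := by gcongr
      _ = 1 := by field_simp
  have h3 : p * a - q * z = 0 := Int.abs_lt_one_iff.mp (by exact_mod_cast h2)
  have h4 : (q : ℤ) ∣ p * a := ⟨z, by linarith⟩
  refine IsCoprime.dvd_of_dvd_mul_left ?_ h4
  rw [Int.isCoprime_iff_gcd_eq_one, Int.gcd, Nat.gcd_comm]
  simpa using hcop

set_option maxHeartbeats 1000000 in
theorem exists_far_from_int {κ : ℝ} (hκ : 1 < κ) : ∃ ε > (0 : ℝ), ∃ d > (0 : ℝ), ∃ η > (0 : ℝ),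
    d < 1 ∧ η < 1 ∧ ∀ᶠ N : ℕ in atTop, ∀ x : ℝ, (N : ℝ) ^ (-κ + η) ≤ |x| → |x| ≤ 1 / 2 →
      ∀ m : ℕ, (N : ℝ) / 2 ≤ m → m ≤ N →
        ∃ l, m ≤ l ∧ (l : ℝ) ≤ m + (N : ℝ) ^ (1 - d) ∧
          ∀ z : ℤ, ε ≤ |x * psPart κ l - z| := by
  set k := ⌈κ⌉₊ with hkdef
  have hk' : κ ≤ k := Nat.le_ceil _
  have hk : (k : ℝ) - 1 < κ := by linarith [Nat.ceil_lt_add_one (show 0 ≤ κ by linarith)]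
  have hk2 : 1 ≤ k := by
    have : (0 : ℝ) < k := by linarith
    exact_mod_cast this
  have hk0 : (0 : ℝ) < k := by exact_mod_cast hk2
  set c := fallingProd κ k with hcdef
  have hc : 0 < c := fallingProd_pos hk
  obtain ⟨Q, hQ⟩ := exists_nat_ge (max (2 ^ (2 * k + 5) : ℝ) (4 * c))
  have hQ1 : (2 ^ (2 * k + 5) : ℝ) ≤ Q := (le_max_left _ _).trans hQ
  have hQ2 : 4 * c ≤ Q := (le_max_right _ _).trans hQ
  have hQ3 : (1 : ℝ) ≤ Q := le_trans (one_le_pow₀ (by norm_num)) hQ1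
  have hQ4 : 1 ≤ Q := by exact_mod_cast hQ3
  have hQ0 : (0 : ℝ) < Q := by linarith
  set ε : ℝ := 1 / (4 * Q ^ 2) with hε
  have hQε : (Q : ℝ) * ε ≤ 1 / Q := by
    rw [hε, mul_one_div, div_le_div_iff₀ (by positivity) hQ0]; nlinarith
  have hQinv : (2 : ℝ) ^ (2 * k + 2) * (2 / Q) ≤ 1 / 4 := by
    rw [mul_div_assoc', div_le_div_iff₀ hQ0 (by norm_num)]
    calc (2 : ℝ) ^ (2 * k + 2) * 2 * 4 = 2 ^ (2 * k + 5) := by ring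
      _ ≤ 1 * Q := by linarith
  have h2ε : 2 * ε ≤ 1 / (2 * Q) := by
    rw [hε, mul_one_div, div_le_div_iff₀ (by positivity) (by positivity)]; nlinarith
  have hQc : 1 / Q * c ≤ 1 / 4 := by
    rw [one_div_mul_eq_div, div_le_div_iff₀ hQ0 (by norm_num)]; linarith
  set η := (κ - k + 1) / 2 with hη
  have hη0 : 0 < η := by rw [hη]; linarith
  have hη1 : η ≤ 1 / 2 := by rw [hη]; linarith
  set d := η / (k + 1) with hd
  have hd0 : 0 < d := by positivity
  have hdη : (k + 1) * d = η := by rw [hd]; field_simp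
  have hd1 : d < η := by nlinarith
  set C : ℝ := 2 ^ ((k : ℝ) - κ) * (2 * k) ^ k / c with hC
  have hC0 : 0 < C := by positivity
  refine ⟨ε, by positivity, d, hd0, η, hη0, by linarith, by linarith, ?_⟩
  have hlim : Tendsto (fun N : ℕ => C * (κ * 2 ^ (κ - 1)) * (N : ℝ) ^ (-d)
      + C * (N : ℝ) ^ (-(κ - k * d))) atTop (𝓝 0) := by
    have h1 : ∀ e : ℝ, 0 < e → Tendsto (fun N : ℕ => (N : ℝ) ^ (-e)) atTop (𝓝 0) := fun e he =>
      (tendsto_rpow_neg_atTop he).comp tendsto_natCast_atTop_atTop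
    have := ((h1 d hd0).const_mul (C * (κ * 2 ^ (κ - 1)))).add
      ((h1 (κ - k * d) (by nlinarith)).const_mul C)
    simpa using this
  filter_upwards [eventually_exists_not_modEq hk2 hk hk' hη0 (by rw [hη]; linarith) hQ4,
    hlim.eventually_lt_const (show (0 : ℝ) < 1 / (2 * Q) by positivity),
    (tendsto_natCast_rpow_atTop hd0).eventually_gt_atTop C,
    (tendsto_natCast_rpow_atTop (e := 1 - d) (by linarith)).eventually_ge_atTop (k : ℝ),
    eventually_ge_atTop 2] with N hmod hsmall hNC hNk hN2 x hx hx2 m hm hmN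
  by_contra! Hcon
  have hN2' : (2 : ℝ) ≤ N := by exact_mod_cast hN2
  have hN0 : (0 : ℝ) < N := by linarith
  have hmN' : (m : ℝ) ≤ N := by exact_mod_cast hmN
  have hle1 : (N : ℝ) ^ (1 - d) ≤ N := by
    calc (N : ℝ) ^ (1 - d) ≤ (N : ℝ) ^ (1 : ℝ) :=
          Real.rpow_le_rpow_of_exponent_le (by linarith) (by linarith)
      _ = N := Real.rpow_one _
  obtain ⟨r, hr, hrQ⟩ := Real.exists_rat_abs_sub_le_and_den_le x (n := Q) hQ4
  set q := r.den with hqdef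
  have hq1 : 1 ≤ q := r.den_pos
  have hq0 : (0 : ℝ) < q := by exact_mod_cast hq1
  have hqQ : (q : ℝ) ≤ Q := by exact_mod_cast hrQ
  set y := x - r with hy
  have hrr : (r : ℝ) = r.num / q := by rw [hqdef]; exact_mod_cast (Rat.num_div_den r).symm
  have hxy : x = (r.num : ℝ) / q + y := by rw [hy, hrr]; ring
  have hY : |q * y| ≤ 1 / Q := by
    rw [abs_mul, abs_of_pos hq0]
    calc (q : ℝ) * |y| ≤ q * (1 / ((Q + 1) * q)) := by gcongr
      _ = 1 / (Q + 1) := by field_simp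
      _ ≤ 1 / Q := by gcongr; linarith
  set H := ⌊(N : ℝ) ^ (1 - d) / k⌋₊ with hHdef
  have hH : (k : ℝ) * H ≤ (N : ℝ) ^ (1 - d) := by
    have : (H : ℝ) ≤ (N : ℝ) ^ (1 - d) / k := Nat.floor_le (by positivity)
    rw [le_div_iff₀ hk0] at this; linarith
  have hH1 : 1 ≤ H := Nat.le_floor (by rw [le_div_iff₀ hk0]; simpa using hNk)
  have hH2 : (N : ℝ) ^ (1 - d) ≤ 2 * k * H := by
    have h1 : (N : ℝ) ^ (1 - d) / k < H + 1 := Nat.lt_floor_add_one _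
    rw [div_lt_iff₀ hk0] at h1
    have h2 : (1 : ℝ) ≤ H := by exact_mod_cast hH1
    nlinarith
  have hgrow := mul_fwdDiff_rpow_le_of_near_int hk hk' hN2' hm (H := H) (Y := q * y) (η := 2 / Q)
    (by linarith) hQinv
    (by
      calc |q * y| * c ≤ 1 / Q * c := by gcongr
        _ ≤ 1 / 4 := hQc)
    (fun l hl hl' => by
      have hl'' : (l : ℝ) ≤ m + k * H := by exact_mod_cast hl'
      obtain ⟨z, hz⟩ := Hcon l hl (by linarith)
      refine ⟨q * z - r.num * psPart κ l, ?_⟩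
      have h1 := psPart_le_rpow κ l
      have h2 := rpow_lt_psPart_add_one κ l
      have e : q * y * (l : ℝ) ^ κ - ((q * z - r.num * psPart κ l : ℤ) : ℝ)
          = q * (x * psPart κ l - z) + q * y * ((l : ℝ) ^ κ - psPart κ l) := by
        rw [hxy]; push_cast; field_simp; ring
      rw [e]
      calc _ ≤ |(q : ℝ) * (x * psPart κ l - z)| + |q * y * ((l : ℝ) ^ κ - psPart κ l)| :=
            abs_add_le _ _
        _ ≤ Q * ε + 1 / Q * 1 := by
          rw [abs_mul, abs_mul (q * y), abs_of_pos hq0]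
          gcongr
          rw [abs_of_nonneg (by linarith)]; linarith
        _ ≤ 1 / Q + 1 / Q * 1 := by gcongr
        _ = 2 / Q := by ring)
    hH1
  have hysmall : |q * y| ≤ C * (N : ℝ) ^ (-(κ - k * d)) := by
    have h1 : (2 : ℝ) ^ k * (2 / Q) ≤ 1 := by
      refine le_trans ?_ (hQinv.trans (by norm_num))
      gcongr
      · norm_num
      · omega
    have h2 : |q * y| * ((((N : ℝ) ^ (1 - d)) / (2 * k)) ^ k * (c * (2 * N) ^ (κ - k))) ≤ 1 := by
      refine le_trans ?_ (hgrow.trans h1)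
      gcongr
      rw [div_le_iff₀ (by positivity)]; linarith
    rw [← le_div_iff₀ (by positivity)] at h2
    refine h2.trans_eq ?_
    have e1 : ((N : ℝ) ^ (1 - d)) ^ k = N ^ ((1 - d) * k) := by
      rw [Real.rpow_mul hN0.le, Real.rpow_natCast]
    have e2 : (2 : ℝ) ^ ((k : ℝ) - κ) = (2 ^ (κ - k))⁻¹ := by
      rw [← Real.rpow_neg (by norm_num)]; ring_nf
    have e3 : (N : ℝ) ^ (-(κ - k * d)) = (N ^ ((1 - d) * k) * (N : ℝ) ^ (κ - k))⁻¹ := by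
      rw [← Real.rpow_add hN0, ← Real.rpow_neg hN0.le]; ring_nf
    rw [hC, e2, e3, div_pow, e1, Real.mul_rpow (by norm_num) hN0.le]
    field_simp
  rcases hq1.eq_or_lt with hqe | hq2
  · rw [← hqe] at hxy hY hysmall
    simp only [Nat.cast_one, div_one, one_mul] at hxy hY hysmall
    have hnum : |(r.num : ℝ)| < 1 := by
      have : |(r.num : ℝ)| ≤ |x| + |y| := by
        rw [show (r.num : ℝ) = x - y by linarith]; exact abs_sub _ _
      have : (1 : ℝ) / Q < 1 / 2 := by
        have : (2 : ℝ) ^ 1 < 2 ^ (2 * k + 5) := pow_lt_pow_right₀ (by norm_num) (by omega)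
        gcongr
        linarith
      linarith
    have hnum0 : r.num = 0 := Int.abs_lt_one_iff.mp (by exact_mod_cast hnum)
    rw [hnum0] at hxy
    simp only [Int.cast_zero, zero_add] at hxy
    rw [← hxy] at hysmall
    have h1 := hx.trans hysmall
    have e : (N : ℝ) ^ (-κ + η) = N ^ d * N ^ (-(κ - k * d)) := by
      rw [← Real.rpow_add hN0, ← hdη]; ring_nf
    rw [e] at h1
    exact absurd (le_of_mul_le_mul_right h1 (by positivity)) (not_le.mpr hNC)
  · obtain ⟨l, hml, hl, hne⟩ := hmod m hm hmN q hq2 hrQ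
    have hexp : (N : ℝ) ^ (1 - η) ≤ N ^ (1 - d) :=
      Real.rpow_le_rpow_of_exponent_le (by linarith) (by linarith)
    obtain ⟨z₁, hz₁⟩ := Hcon l hml (by linarith)
    obtain ⟨z₂, hz₂⟩ := Hcon m le_rfl (by linarith [Real.rpow_pos_of_pos hN0 (1 - d)])
    refine hne (Nat.modEq_iff_dvd.mpr ?_)
    rw [← dvd_neg, neg_sub]
    refine dvd_of_abs_mul_sub_lt (p := r.num) (y := y) (z := z₁ - z₂) r.reduced hq1 ?_
    rw [← hxy]
    push_cast
    have hml' : (m : ℝ) ≤ l := by exact_mod_cast hml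
    have hm0 : (0 : ℝ) < m := by linarith
    have hpm : psPart κ m ≤ psPart κ l :=
      Nat.floor_le_floor (Real.rpow_le_rpow hm0.le hml' (by linarith))
    have hpm' : (psPart κ m : ℝ) ≤ psPart κ l := by exact_mod_cast hpm
    have hinc : (psPart κ l : ℝ) - psPart κ m ≤ κ * (2 * N) ^ (κ - 1) * N ^ (1 - η) + 1 := by
      have h1 := psPart_le_rpow κ l
      have h2 := rpow_lt_psPart_add_one κ m
      have h3 := rpow_sub_rpow_le hκ hm0 hml'
      have h4 : κ * (l : ℝ) ^ (κ - 1) * (l - m) ≤ κ * (2 * N) ^ (κ - 1) * N ^ (1 - η) := by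
        gcongr
        · linarith
        · linarith
      linarith
    have hyy : |y| ≤ C * (N : ℝ) ^ (-(κ - k * d)) := by
      refine le_trans ?_ hysmall
      rw [abs_mul, abs_of_pos hq0]
      exact le_mul_of_one_le_left (abs_nonneg _) (by exact_mod_cast hq1)
    have hya : |y * ((psPart κ l : ℝ) - psPart κ m)| < 1 / (2 * Q) := by
      rw [abs_mul, abs_of_nonneg (sub_nonneg.mpr hpm')]
      calc _ ≤ C * (N : ℝ) ^ (-(κ - k * d)) * (κ * (2 * N) ^ (κ - 1) * N ^ (1 - η) + 1) := by
            gcongr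
        _ = C * (κ * 2 ^ (κ - 1)) * (N : ℝ) ^ (-d) + C * (N : ℝ) ^ (-(κ - k * d)) := by
            have : (N : ℝ) ^ (-d) = N ^ (-(κ - k * d)) * N ^ (κ - 1) * N ^ (1 - η) := by
              rw [← Real.rpow_add hN0, ← Real.rpow_add hN0, ← hdη]; ring_nf
            rw [this, Real.mul_rpow (by norm_num) hN0.le]; ring
        _ < _ := hsmall
    have hxa : |x * ((psPart κ l : ℝ) - psPart κ m) - (z₁ - z₂)| ≤ 2 * ε := by
      calc _ = |(x * psPart κ l - z₁) - (x * psPart κ m - z₂)| := by ring_nf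
        _ ≤ _ := abs_sub _ _
        _ ≤ _ := by linarith
    calc _ < 1 / (2 * (Q : ℝ)) + 1 / (2 * Q) := by linarith
      _ = 1 / Q := by field_simp; norm_num
      _ ≤ 1 / q := by gcongr

theorem abs_le_abs_sub_intCast {y : ℝ} (hy : |y| ≤ 1 / 2) (z : ℤ) : |y| ≤ |y - z| := by
  rcases eq_or_ne z 0 with rfl | hz
  · simp
  have h1 : (1 : ℝ) ≤ |(z : ℝ)| := by exact_mod_cast Int.one_le_abs hz
  have h2 : |(z : ℝ)| ≤ |y| + |y - z| := by
    calc |(z : ℝ)| = |y - (y - z)| := by ring_nf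
      _ ≤ _ := abs_sub _ _
  linarith

theorem eventually_const_mul_natCast_rpow_le {a b : ℝ} (hab : a < b) (C : ℝ) :
    ∀ᶠ N : ℕ in atTop, C * (N : ℝ) ^ a ≤ (N : ℝ) ^ b := by
  filter_upwards [(tendsto_natCast_rpow_atTop (sub_pos.mpr hab)).eventually_ge_atTop C,
    eventually_gt_atTop 0] with N hN hN0
  have hN0' : (0 : ℝ) < N := by exact_mod_cast hN0
  calc C * (N : ℝ) ^ a ≤ (N : ℝ) ^ (b - a) * (N : ℝ) ^ a := by gcongr
    _ = _ := by rw [← Real.rpow_add hN0']; ring_nf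

theorem card_mul_le_sum_of_injOn {f : ℕ → ℝ} (hf : ∀ l, 0 ≤ f l) {K N : ℕ} {g : ℕ → ℕ} {e : ℝ}
    (hg : Set.InjOn g (Finset.range K : Set ℕ)) (hg1 : ∀ j < K, 1 ≤ g j) (hgN : ∀ j < K, g j ≤ N)
    (hfe : ∀ j < K, e ≤ f (g j)) : K * e ≤ ∑ l ∈ Finset.range N, f (l + 1) := by
  have hinj : Set.InjOn (fun j => g j - 1) (Finset.range K : Set ℕ) := by
    intro i hi j hj hij
    have hi' := hg1 i (by simpa using hi)
    have hj' := hg1 j (by simpa using hj)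
    refine hg hi hj ?_
    simp only at hij
    omega
  calc (K : ℝ) * e = ∑ _j ∈ Finset.range K, e := by simp
    _ ≤ ∑ j ∈ Finset.range K, f ((g j - 1) + 1) := by
        refine Finset.sum_le_sum fun j hj => ?_
        have hj' := Finset.mem_range.mp hj
        rw [Nat.sub_add_cancel (hg1 j hj')]
        exact hfe j hj'
    _ = ∑ l ∈ (Finset.range K).image (fun j => g j - 1), f (l + 1) := by
        rw [Finset.sum_image hinj]
    _ ≤ _ := by
        refine Finset.sum_le_sum_of_subset_of_nonneg ?_ fun _ _ _ => hf _
        intro l hl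
        obtain ⟨j, hj, rfl⟩ := Finset.mem_image.mp hl
        have hj' := Finset.mem_range.mp hj
        have := hg1 j hj'
        have := hgN j hj'
        exact Finset.mem_range.mpr (by omega)

theorem le_sum_sq_sub_round_of_mul_rpow_le {κ : ℝ} (hκ : 0 < κ) {M N : ℕ} (hM : 1 ≤ M)
    (hMN : M ≤ N) {x : ℝ} (hx : |x| * (M : ℝ) ^ κ ≤ 1 / 2) :
    (1 / 2) ^ (2 * κ + 1) / 4 * (M : ℝ) ^ (2 * κ + 1) * x ^ 2 ≤
      ∑ l ∈ Finset.range N, (x * psPart κ (l + 1) - round (x * psPart κ (l + 1) : ℝ)) ^ 2 := by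
  have hM0 : (0 : ℝ) < M := by exact_mod_cast hM
  have hterm : ∀ l ∈ Finset.Ico (M / 2) M, x ^ 2 * ((M : ℝ) / 2) ^ (2 * κ) / 4 ≤
      (x * psPart κ (l + 1) - round (x * psPart κ (l + 1) : ℝ)) ^ 2 := by
    intro l hl
    obtain ⟨hl1, hl2⟩ := Finset.mem_Ico.mp hl
    have hl1' : (M : ℝ) / 2 ≤ ((l + 1 : ℕ) : ℝ) := by
      rw [div_le_iff₀ (by norm_num)]
      exact_mod_cast (by omega : M ≤ (l + 1) * 2)
    have h1 := psPart_le_rpow κ (l + 1)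
    have h2 := rpow_lt_psPart_add_one κ (l + 1)
    have h3 : ((M : ℝ) / 2) ^ κ ≤ ((l + 1 : ℕ) : ℝ) ^ κ :=
      Real.rpow_le_rpow (by positivity) hl1' hκ.le
    have h4 : ((l + 1 : ℕ) : ℝ) ^ κ ≤ (M : ℝ) ^ κ :=
      Real.rpow_le_rpow (by positivity) (by exact_mod_cast hl2) hκ.le
    have h5 : (1 : ℝ) ≤ psPart κ (l + 1) := by
      have : 1 ≤ psPart κ (l + 1) := by
        refine Nat.le_floor ?_
        rw [Nat.cast_one]
        exact Real.one_le_rpow (by push_cast; linarith [(Nat.cast_nonneg l : (0 : ℝ) ≤ l)]) hκ.le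
      exact_mod_cast this
    have h6 : ((M : ℝ) / 2) ^ κ / 2 ≤ psPart κ (l + 1) := by linarith
    have h7 : |x * psPart κ (l + 1)| ≤ 1 / 2 := by
      rw [abs_mul, abs_of_nonneg (by positivity : (0 : ℝ) ≤ psPart κ (l + 1))]
      exact le_trans (by gcongr; linarith) hx
    have h8 := abs_le_abs_sub_intCast h7 (round (x * psPart κ (l + 1) : ℝ))
    refine le_trans ?_ (sq_le_sq.mpr h8)
    rw [mul_comm 2 κ, Real.rpow_mul (by positivity), mul_pow, Real.rpow_two]
    have : (((M : ℝ) / 2) ^ κ / 2) ^ 2 ≤ (psPart κ (l + 1) : ℝ) ^ 2 := by gcongr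
    nlinarith [sq_nonneg x]
  have hcard : (M : ℝ) / 2 ≤ ((Finset.Ico (M / 2) M).card : ℝ) := by
    rw [Nat.card_Ico, div_le_iff₀ (by norm_num)]
    exact_mod_cast (by omega : M ≤ (M - M / 2) * 2)
  calc _ = (M : ℝ) / 2 * (x ^ 2 * ((M : ℝ) / 2) ^ (2 * κ) / 4) := by
        rw [Real.div_rpow hM0.le (by norm_num), Real.rpow_add hM0, Real.rpow_add (by norm_num),
          Real.div_rpow (by norm_num) (by norm_num), Real.one_rpow, Real.rpow_one, Real.rpow_one]
        ring
    _ ≤ (Finset.Ico (M / 2) M).card • (x ^ 2 * ((M : ℝ) / 2) ^ (2 * κ) / 4) := by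
        rw [nsmul_eq_mul]; gcongr
    _ ≤ ∑ l ∈ Finset.Ico (M / 2) M,
          (x * psPart κ (l + 1) - round (x * psPart κ (l + 1) : ℝ)) ^ 2 :=
        Finset.card_nsmul_le_sum _ _ _ hterm
    _ ≤ _ := by
        refine Finset.sum_le_sum_of_subset_of_nonneg ?_ fun _ _ _ => sq_nonneg _
        intro l hl
        exact Finset.mem_range.mpr (by have := (Finset.mem_Ico.mp hl).2; omega)

theorem eventually_rpow_le_sum_sq_sub_round_of_small {κ η : ℝ} (hκ : 1 < κ) (hη : 0 < η)
    (hη1 : η < 1) {δ : ℝ} (hδ : δ < 1 - η) :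
    ∀ᶠ N : ℕ in atTop, ∀ x : ℝ, 1 / 2 < |x| * (N : ℝ) ^ κ → |x| ≤ (N : ℝ) ^ (-κ + η) →
      (N : ℝ) ^ δ ≤
        ∑ l ∈ Finset.range N, (x * psPart κ (l + 1) - round (x * psPart κ (l + 1) : ℝ)) ^ 2 := by
  set c : ℝ := (1 / 2) ^ (2 * κ + 1) / 4 with hc
  have hc0 : 0 < c := by positivity
  set c' : ℝ := c * (1 / 2) ^ (2 * κ + 1) / 4 * (1 / 2) with hc'
  have hc'0 : 0 < c' := by positivity
  filter_upwards [eventually_const_mul_natCast_rpow_le hδ (1 / c'), eventually_ge_atTop 1,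
    (tendsto_natCast_rpow_atTop (sub_pos.mpr hη1)).eventually_ge_atTop 2] with N hN hN1 hN2 x hx hx'
  have hN0 : (0 : ℝ) < N := by exact_mod_cast hN1
  have hκ0 : 0 < κ := by linarith
  have hx0 : 0 < |x| := by
    by_contra! h
    nlinarith [Real.rpow_pos_of_pos hN0 κ]
  set R : ℝ := (1 / (2 * |x|)) ^ (1 / κ) with hR
  have hR0 : 0 < R := by positivity
  have hRκ : R ^ κ = 1 / (2 * |x|) := by
    rw [hR, ← Real.rpow_mul (by positivity), one_div_mul_cancel hκ0.ne', Real.rpow_one]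
  have hRN : R ≤ N := by
    refine (Real.rpow_le_rpow_iff hR0.le hN0.le hκ0).mp ?_
    rw [hRκ, div_le_iff₀ (by positivity)]
    linarith
  have hRlow : (1 / 2) * (N : ℝ) ^ (1 - η) ≤ R := by
    refine (Real.rpow_le_rpow_iff (by positivity) hR0.le hκ0).mp ?_
    rw [hRκ, Real.mul_rpow (by norm_num) (by positivity), ← Real.rpow_mul hN0.le]
    have h1 : ((1 : ℝ) / 2) ^ κ ≤ 1 / 2 := by
      simpa using Real.rpow_le_rpow_of_exponent_ge (by norm_num : (0 : ℝ) < 1 / 2) (by norm_num)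
        hκ.le
    have h2 : (N : ℝ) ^ ((1 - η) * κ) ≤ (N : ℝ) ^ (κ - η) :=
      Real.rpow_le_rpow_of_exponent_le (by exact_mod_cast hN1) (by nlinarith)
    have h3 : (N : ℝ) ^ (κ - η) ≤ 1 / |x| := by
      rw [le_div_iff₀ hx0]
      calc _ ≤ (N : ℝ) ^ (κ - η) * (N : ℝ) ^ (-κ + η) := by gcongr
        _ = 1 := by rw [← Real.rpow_add hN0]; simp
    calc _ ≤ 1 / 2 * (1 / |x|) := by gcongr; exact h2.trans h3
      _ = _ := by ring
  have hR1 : 1 ≤ R := by linarith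
  set M := ⌊R⌋₊ with hM
  have hM1 : 1 ≤ M := Nat.le_floor (by simpa using hR1)
  have hMR : (M : ℝ) ≤ R := Nat.floor_le hR0.le
  have hRM : R / 2 ≤ M := by
    have h1 := Nat.lt_floor_add_one R
    have h2 : (1 : ℝ) ≤ M := by exact_mod_cast hM1
    rw [← hM] at h1
    linarith
  have key := le_sum_sq_sub_round_of_mul_rpow_le hκ0 (N := N) hM1
    (by exact_mod_cast hMR.trans hRN) (x := x) (by
      calc |x| * (M : ℝ) ^ κ ≤ |x| * R ^ κ := by gcongr
        _ = 1 / 2 := by rw [hRκ]; field_simp)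
  refine le_trans ?_ key
  have hx2 : x ^ 2 = R ^ (-(2 * κ)) / 4 := by
    rw [← sq_abs, Real.rpow_neg hR0.le, mul_comm 2 κ, Real.rpow_mul hR0.le, hRκ, Real.rpow_two]
    field_simp; norm_num
  calc (N : ℝ) ^ δ = c' * (1 / c' * (N : ℝ) ^ δ) := by field_simp
    _ ≤ c' * (N : ℝ) ^ (1 - η) := by gcongr
    _ = c * (1 / 2) ^ (2 * κ + 1) / 4 * (1 / 2 * (N : ℝ) ^ (1 - η)) := by rw [hc']; ring
    _ ≤ c * (1 / 2) ^ (2 * κ + 1) / 4 * R := by gcongr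
    _ = c * (R / 2) ^ (2 * κ + 1) * x ^ 2 := by
        rw [hx2, div_eq_mul_one_div R, Real.mul_rpow hR0.le (by norm_num), Real.rpow_neg hR0.le,
          Real.rpow_add hR0, Real.rpow_one]
        field_simp
    _ ≤ _ := by gcongr

theorem exists_rpow_le_sum_sq_sub_round_of_large {κ : ℝ} (hκ : 1 < κ) :
    ∃ η > 0, ∃ δ : ℝ, 0 < δ ∧ η < 1 ∧ ∀ᶠ N : ℕ in atTop, ∀ x : ℝ, (N : ℝ) ^ (-κ + η) ≤ |x| → |x| ≤ 1 / 2 →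
      (N : ℝ) ^ δ ≤
        ∑ l ∈ Finset.range N, (x * psPart κ (l + 1) - round (x * psPart κ (l + 1) : ℝ)) ^ 2 := by
  obtain ⟨ε, hε, d, hd, η, hη, hd1, hη1, H⟩ := exists_far_from_int hκ
  refine ⟨η, hη, d / 4, by positivity, hη1, ?_⟩
  filter_upwards [H, eventually_ge_atTop 8,
    eventually_const_mul_natCast_rpow_le (by linarith : d / 4 < d / 2) (2 / ε ^ 2),
    eventually_const_mul_natCast_rpow_le (by linarith : 1 - d / 2 < 1) 8,
    (tendsto_natCast_rpow_atTop (sub_pos.mpr hd1)).eventually_ge_atTop 1,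
    (tendsto_natCast_rpow_atTop (half_pos hd)).eventually_ge_atTop 2]
    with N hN hN8 hN1 hN2 hN3 hN4 x hx hx'
  have hN0 : (0 : ℝ) < N := by exact_mod_cast (by omega : 0 < N)
  have hN8' : (8 : ℝ) ≤ N := by exact_mod_cast hN8
  set w := ⌊(N : ℝ) ^ (1 - d)⌋₊ with hw
  set K := ⌊(N : ℝ) ^ (d / 2)⌋₊ with hK
  have hwle : (w : ℝ) ≤ (N : ℝ) ^ (1 - d) := Nat.floor_le (by positivity)
  have hKle : (K : ℝ) ≤ (N : ℝ) ^ (d / 2) := Nat.floor_le (by positivity)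
  have hKge : (N : ℝ) ^ (d / 2) / 2 ≤ K := by
    have := Nat.lt_floor_add_one ((N : ℝ) ^ (d / 2))
    rw [← hK] at this
    linarith
  have hhalf : (N : ℝ) / 2 ≤ ((N / 2 + 1 : ℕ) : ℝ) := by
    rw [div_le_iff₀ (by norm_num)]
    exact_mod_cast (by omega : N ≤ (N / 2 + 1) * 2)
  have hhalf' : ((N / 2 : ℕ) : ℝ) ≤ (N : ℝ) / 2 := Nat.cast_div_le
  have hKw : (K : ℝ) * (w + 1) ≤ N / 4 := by
    calc (K : ℝ) * (w + 1) ≤ (N : ℝ) ^ (d / 2) * (2 * (N : ℝ) ^ (1 - d)) := by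
          gcongr; linarith
      _ = 2 * (N : ℝ) ^ (1 - d / 2) := by
          rw [mul_left_comm, ← Real.rpow_add hN0]; ring_nf
      _ ≤ _ := by rw [Real.rpow_one] at hN2; linarith
  have hend : N / 2 + 1 + K * (w + 1) ≤ N := by
    have : ((N / 2 + 1 + K * (w + 1) : ℕ) : ℝ) ≤ N := by push_cast; linarith
    exact_mod_cast this
  have hmj : ∀ j < K, N / 2 + 1 + j * (w + 1) + w < N := by
    intro j hj
    have : (j + 1) * (w + 1) ≤ K * (w + 1) := Nat.mul_le_mul_right _ hj
    nlinarith
  have hex : ∀ j, ∃ l, j < K → N / 2 + 1 + j * (w + 1) ≤ l ∧ l < N / 2 + 1 + (j + 1) * (w + 1) ∧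
      ∀ z : ℤ, ε ≤ |x * psPart κ l - z| := by
    intro j
    by_cases hj : j < K
    · obtain ⟨l, h1, h2, h3⟩ := hN x hx hx' (N / 2 + 1 + j * (w + 1))
        (hhalf.trans (by exact_mod_cast Nat.le_add_right _ _)) (by have := hmj j hj; omega)
      refine ⟨l, fun _ => ⟨h1, ?_, h3⟩⟩
      have h4 : ((l - (N / 2 + 1 + j * (w + 1)) : ℕ) : ℝ) ≤ (N : ℝ) ^ (1 - d) := by
        rw [Nat.cast_sub h1]; linarith
      have h5 : l - (N / 2 + 1 + j * (w + 1)) ≤ w := Nat.le_floor h4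
      have h6 : (j + 1) * (w + 1) = j * (w + 1) + (w + 1) := by ring
      omega
    · exact ⟨0, fun h => absurd h hj⟩
  choose g hg using hex
  have hsum := card_mul_le_sum_of_injOn (K := K) (N := N) (g := g) (e := ε ^ 2)
    (f := fun l => (x * psPart κ l - round (x * psPart κ l : ℝ)) ^ 2)
    (fun _ => sq_nonneg _) (by
      have hmono : ∀ i j, i < j → j < K → g i < g j := by
        intro i j hij hj
        have h1 := (hg i (hij.trans hj)).2.1
        have h2 := (hg j hj).1
        have h3 : (i + 1) * (w + 1) ≤ j * (w + 1) := Nat.mul_le_mul_right _ hij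
        omega
      intro i hi j hj hij
      have hi' : i < K := by simpa using hi
      have hj' : j < K := by simpa using hj
      rcases lt_trichotomy i j with h | h | h
      · exact absurd hij (hmono i j h hj').ne
      · exact h
      · exact absurd hij (hmono j i h hi').ne')
    (fun j hj => by have := (hg j hj).1; omega)
    (fun j hj => by
      have h1 := (hg j hj).2.1
      have h2 : (j + 1) * (w + 1) ≤ K * (w + 1) := Nat.mul_le_mul_right _ hj
      omega)
    (fun j hj => by
      rw [← sq_abs (_ - _)]
      exact pow_le_pow_left₀ hε.le ((hg j hj).2.2 _) 2)
  refine le_trans ?_ hsum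
  calc (N : ℝ) ^ (d / 4) = (2 / ε ^ 2 * (N : ℝ) ^ (d / 4)) / 2 * ε ^ 2 := by field_simp
    _ ≤ (N : ℝ) ^ (d / 2) / 2 * ε ^ 2 := by gcongr
    _ ≤ _ := by gcongr

theorem exists_min_le_sum_sq_sub_round {κ : ℝ} (hκ : 1 < κ) :
    ∃ c > 0, ∃ δ : ℝ, 0 < δ ∧ ∀ᶠ N : ℕ in atTop, ∀ x : ℝ, |x| ≤ 1 / 2 →
      min (c * ((N : ℝ) ^ (2 * κ + 1) * x ^ 2)) ((N : ℝ) ^ δ) ≤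
        ∑ l ∈ Finset.range N, (x * psPart κ (l + 1) - round (x * psPart κ (l + 1) : ℝ)) ^ 2 := by
  obtain ⟨η, hη, δ, hδ, hη1, H⟩ := exists_rpow_le_sum_sq_sub_round_of_large hκ
  have hδ' : (1 - η) / 2 < 1 - η := by linarith
  refine ⟨(1 / 2) ^ (2 * κ + 1) / 4, by positivity, min δ ((1 - η) / 2),
    lt_min hδ (by linarith), ?_⟩
  filter_upwards [H, eventually_rpow_le_sum_sq_sub_round_of_small hκ hη hη1 hδ',
    eventually_ge_atTop 1] with N hN hN' hN1 x hx
  have hN1' : (1 : ℝ) ≤ N := by exact_mod_cast hN1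
  rcases le_or_gt (|x| * (N : ℝ) ^ κ) (1 / 2) with h1 | h1
  · refine (min_le_left _ _).trans ?_
    rw [← mul_assoc]
    exact le_sum_sq_sub_round_of_mul_rpow_le (by linarith) hN1 le_rfl h1
  refine (min_le_right _ _).trans ?_
  rcases le_total |x| ((N : ℝ) ^ (-κ + η)) with h2 | h2
  · exact (Real.rpow_le_rpow_of_exponent_le hN1' (min_le_right _ _)).trans (hN' x h1 h2)
  · exact (Real.rpow_le_rpow_of_exponent_le hN1' (min_le_left _ _)).trans (hN x h2 hx)

theorem abs_integral_sub_trapezoid_le {g g' : ℝ → ℝ} {a b D : ℝ} (hab : a < b)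
    (hg : ContinuousOn g (Set.Icc a b)) (hgd : ∀ x ∈ Set.Ioo a b, HasDerivAt g (g' x) x)
    (hD : ∀ x ∈ Set.Icc a b, |g' x - g' a| ≤ D) :
    |(∫ x in a..b, g x) - (b - a) * ((g a + g b) / 2)| ≤ D * (b - a) ^ 2 := by
  have hpt : ∀ x ∈ Set.Icc a b, |g x - (g a + g' a * (x - a))| ≤ D * (x - a) := by
    intro x hx
    rcases hx.1.eq_or_lt with rfl | hax
    · simp
    obtain ⟨y, hy, hy'⟩ := exists_hasDerivAt_eq_slope g g' hax
      (hg.mono (Set.Icc_subset_Icc_right hx.2))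
      (fun z hz => hgd z ⟨hz.1, hz.2.trans_le hx.2⟩)
    have h0 : 0 < x - a := sub_pos.mpr hax
    have h1 : g x - (g a + g' a * (x - a)) = (g' y - g' a) * (x - a) := by
      rw [eq_div_iff h0.ne'] at hy'
      linarith
    rw [h1, abs_mul, abs_of_pos h0]
    exact mul_le_mul_of_nonneg_right (hD y ⟨hy.1.le, hy.2.le.trans hx.2⟩) h0.le
  have hlin : IntervalIntegrable (fun x => g a + g' a * (x - a)) MeasureTheory.volume a b :=
    Continuous.intervalIntegrable (by fun_prop) _ _
  have hgi : IntervalIntegrable g MeasureTheory.volume a b :=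
    ContinuousOn.intervalIntegrable (by rwa [Set.uIcc_of_le hab.le])
  have h1 : |∫ x in a..b, (g x - (g a + g' a * (x - a)))| ≤ ∫ x in a..b, D * (x - a) := by
    rw [← Real.norm_eq_abs]
    refine intervalIntegral.norm_integral_le_of_norm_le hab.le (Filter.Eventually.of_forall ?_)
      (Continuous.intervalIntegrable (by fun_prop) _ _)
    intro x hx
    exact hpt x ⟨hx.1.le, hx.2⟩
  have e1 : ∀ c : ℝ, ∫ x in a..b, c * (x - a) = c * (b - a) ^ 2 / 2 := by
    intro c
    rw [intervalIntegral.integral_const_mul, intervalIntegral.integral_sub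
      (Continuous.intervalIntegrable (by fun_prop) _ _)
      (Continuous.intervalIntegrable (by fun_prop) _ _), integral_id,
      intervalIntegral.integral_const, smul_eq_mul]
    ring
  have e2 : ∫ x in a..b, (g a + g' a * (x - a)) = g a * (b - a) + g' a * (b - a) ^ 2 / 2 := by
    rw [intervalIntegral.integral_add (Continuous.intervalIntegrable (by fun_prop) _ _)
      (Continuous.intervalIntegrable (by fun_prop) _ _), e1, intervalIntegral.integral_const,
      smul_eq_mul]
    ring
  rw [intervalIntegral.integral_sub hgi hlin, e1, e2] at h1
  have h2 := hpt b ⟨hab.le, le_rfl⟩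
  have h0 : 0 < b - a := sub_pos.mpr hab
  have h3 : |(b - a) / 2 * (g b - (g a + g' a * (b - a)))| ≤ D * (b - a) ^ 2 / 2 := by
    rw [abs_mul, abs_of_pos (by positivity)]
    calc _ ≤ (b - a) / 2 * (D * (b - a)) := by gcongr
      _ = _ := by ring
  calc _ = |((∫ x in a..b, g x) - (g a * (b - a) + g' a * (b - a) ^ 2 / 2)) -
        (b - a) / 2 * (g b - (g a + g' a * (b - a)))| := by ring_nf
    _ ≤ _ := abs_sub _ _
    _ ≤ D * (b - a) ^ 2 / 2 + D * (b - a) ^ 2 / 2 := add_le_add h1 h3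
    _ = _ := by ring

theorem abs_sub_le_integral_of_abs_deriv_le {g g' m : ℝ → ℝ} {a b : ℝ} (hab : a ≤ b)
    (hg : ContinuousOn g (Set.Icc a b)) (hgd : ∀ x ∈ Set.Ioo a b, HasDerivAt g (g' x) x)
    (hm : ∀ x ∈ Set.Ioo a b, |g' x| ≤ m x) (hmi : MeasureTheory.IntegrableOn m (Set.Icc a b)) :
    |g b - g a| ≤ ∫ x in a..b, m x := by
  rw [abs_le']
  constructor
  · exact intervalIntegral.sub_le_integral_of_hasDeriv_right_of_le hab hg
      (fun x hx => (hgd x hx).hasDerivWithinAt) hmi (fun x hx => (le_abs_self _).trans (hm x hx))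
  · have := intervalIntegral.sub_le_integral_of_hasDeriv_right_of_le hab hg.neg
      (fun x hx => (hgd x hx).neg.hasDerivWithinAt) hmi
      (fun x hx => (neg_le_abs _).trans (hm x hx))
    simpa [neg_add_eq_sub, sub_eq_add_neg, add_comm] using this

theorem abs_sum_sub_integral_le {g g' g'' m : ℝ → ℝ} {t : ℝ} (ht : 0 < t)
    (hg : ContinuousOn g (Set.Ici 0)) (hg' : ContinuousOn g' (Set.Ici 0))
    (hgd : ∀ x > 0, HasDerivAt g (g' x) x) (hgd' : ∀ x > 0, HasDerivAt g' (g'' x) x)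
    (hm : ∀ x > 0, |g'' x| ≤ m x) (hmi : MeasureTheory.IntegrableOn m (Set.Ioi 0)) (n : ℕ) :
    |(∑ l ∈ Finset.range n, g (t * (l + 1 : ℕ))) + (g 0 - g (t * n)) / 2 -
      t⁻¹ * ∫ x in (0 : ℝ)..(t * n), g x| ≤ t * ∫ x in Set.Ioi 0, m x := by
  have hm0 : ∀ x > 0, 0 ≤ m x := fun x hx => (abs_nonneg _).trans (hm x hx)
  have hmi' : ∀ a b : ℝ, 0 ≤ a → MeasureTheory.IntegrableOn m (Set.Icc a b) := by
    intro a b ha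
    rw [integrableOn_Icc_iff_integrableOn_Ioc]
    exact hmi.mono_set (fun x hx => ha.trans_lt hx.1)
  have hintg : ∀ a b : ℝ, 0 ≤ a → 0 ≤ b → IntervalIntegrable g MeasureTheory.volume a b := by
    intro a b ha hb
    refine ContinuousOn.intervalIntegrable (hg.mono fun x hx => ?_)
    exact (le_min ha hb).trans hx.1
  have hcell : ∀ l : ℕ, |t⁻¹ * (∫ x in (t * l)..(t * (l + 1 : ℕ)), g x) -
      (g (t * l) + g (t * (l + 1 : ℕ))) / 2| ≤ t * ∫ x in (t * l)..(t * (l + 1 : ℕ)), m x := by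
    intro l
    have h0 : 0 ≤ t * l := by positivity
    have hlt : t * l < t * (l + 1 : ℕ) := by push_cast; nlinarith
    have hsub : t * (l + 1 : ℕ) - t * l = t := by push_cast; ring
    have h1 := abs_integral_sub_trapezoid_le (g := g) (g' := g')
      (D := ∫ x in (t * l)..(t * (l + 1 : ℕ)), m x) hlt
      (hg.mono fun x hx => h0.trans hx.1) (fun x hx => hgd x (h0.trans_lt hx.1)) (by
        intro x hx
        refine (abs_sub_le_integral_of_abs_deriv_le (m := m) (g' := g'') hx.1
          (hg'.mono fun y hy => h0.trans hy.1)
          (fun y hy => hgd' y (h0.trans_lt hy.1)) (fun y hy => hm y (h0.trans_lt hy.1))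
          (hmi' _ _ h0)).trans ?_
        rw [intervalIntegral.integral_of_le hx.1, intervalIntegral.integral_of_le hlt.le]
        refine MeasureTheory.setIntegral_mono_set
          ((hmi' _ _ h0).mono_set Set.Ioc_subset_Icc_self) ?_
          (Set.Ioc_subset_Ioc_right hx.2).eventuallyLE
        exact (MeasureTheory.ae_restrict_mem measurableSet_Ioc).mono
          fun y hy => hm0 y (h0.trans_lt hy.1))
    rw [hsub] at h1
    have h2 : t⁻¹ * (∫ x in (t * l)..(t * (l + 1 : ℕ)), g x) -
      (g (t * l) + g (t * (l + 1 : ℕ))) / 2 = t⁻¹ * ((∫ x in (t * l)..(t * (l + 1 : ℕ)), g x) -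
        t * ((g (t * l) + g (t * (l + 1 : ℕ))) / 2)) := by field_simp
    rw [h2, abs_mul, abs_of_pos (inv_pos.mpr ht), inv_mul_le_iff₀ ht]
    linarith
  have hsum1 : ∑ l ∈ Finset.range n, ∫ x in (t * l)..(t * (l + 1 : ℕ)), g x =
      ∫ x in (0 : ℝ)..(t * n), g x := by
    have := intervalIntegral.sum_integral_adjacent_intervals (f := g)
      (μ := MeasureTheory.volume) (a := fun l : ℕ => t * l) (n := n)
      (fun k _ => hintg _ _ (by positivity) (by positivity))
    simpa using this
  have hsum2 : ∑ l ∈ Finset.range n, ∫ x in (t * l)..(t * (l + 1 : ℕ)), m x =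
      ∫ x in (0 : ℝ)..(t * n), m x := by
    have := intervalIntegral.sum_integral_adjacent_intervals (f := m)
      (μ := MeasureTheory.volume) (a := fun l : ℕ => t * l) (n := n)
      (fun k _ => by
        have hle : t * (k : ℝ) ≤ t * ((k + 1 : ℕ) : ℝ) := by push_cast; nlinarith
        rw [intervalIntegrable_iff_integrableOn_Icc_of_le hle]
        exact hmi' _ _ (by positivity))
    simpa using this
  have hsum3 : ∑ l ∈ Finset.range n, (g (t * l) + g (t * (l + 1 : ℕ))) / 2 =
      (∑ l ∈ Finset.range n, g (t * (l + 1 : ℕ))) + (g 0 - g (t * n)) / 2 := by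
    clear hsum1 hsum2
    induction n with
    | zero => simp
    | succ n ih => rw [Finset.sum_range_succ, Finset.sum_range_succ, ih]; ring
  rw [← hsum3, ← hsum1, Finset.mul_sum, ← Finset.sum_sub_distrib]
  refine (Finset.abs_sum_le_sum_abs _ _).trans ?_
  calc _ ≤ ∑ l ∈ Finset.range n, t * ∫ x in (t * l)..(t * (l + 1 : ℕ)), m x :=
        Finset.sum_le_sum fun l _ => by rw [abs_sub_comm]; exact hcell l
    _ = t * ∫ x in (0 : ℝ)..(t * n), m x := by rw [← Finset.mul_sum, hsum2]
    _ ≤ _ := by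
        gcongr
        rw [intervalIntegral.integral_of_le (by positivity)]
        refine MeasureTheory.setIntegral_mono_set hmi ?_ Set.Ioc_subset_Ioi_self.eventuallyLE
        exact (MeasureTheory.ae_restrict_mem measurableSet_Ioi).mono fun y hy => hm0 y hy

theorem hasSum_realZeta {s : ℝ} (hs : 1 < s) :
    HasSum (fun k : ℕ => 1 / ((k : ℝ) + 1) ^ s) (realZeta s) := by
  have hsum : Summable (fun k : ℕ => 1 / ((k : ℝ) + 1) ^ s) := by
    refine ((Real.summable_one_div_nat_add_rpow 1 s).mpr hs).congr fun k => ?_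
    rw [abs_of_pos (by positivity)]
  have : realZeta s = ∑' k : ℕ, 1 / ((k : ℝ) + 1) ^ s := by
    rw [realZeta, zeta_eq_tsum_one_div_nat_add_one_cpow (by simpa using hs)]
    have h : ∀ k : ℕ, 1 / ((k : ℂ) + 1) ^ (s : ℂ) = ((1 / ((k : ℝ) + 1) ^ s : ℝ) : ℂ) := by
      intro k
      rw [Complex.ofReal_div, Complex.ofReal_cpow (by positivity)]
      push_cast
      rfl
    simp_rw [h]
    rw [← Complex.ofReal_tsum, Complex.ofReal_re]
  rw [this]
  exact hsum.hasSum

theorem hasSum_alternating_realZeta {s : ℝ} (hs : 1 < s) :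
    HasSum (fun k : ℕ => (-1 : ℝ) ^ k / ((k : ℝ) + 1) ^ s) ((1 - 2 ^ (1 - s)) * realZeta s) := by
  have hZ := hasSum_realZeta hs
  have hodd : HasSum (fun k : ℕ => 1 / (((2 * k + 1 : ℕ) : ℝ) + 1) ^ s)
      (2 ^ (-s) * realZeta s) := by
    refine (hZ.mul_left (2 ^ (-s) : ℝ)).congr_fun fun k => ?_
    have h : ((2 * k + 1 : ℕ) : ℝ) + 1 = 2 * ((k : ℝ) + 1) := by push_cast; ring
    rw [h, Real.mul_rpow (by norm_num) (by positivity), Real.rpow_neg (by norm_num)]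
    field_simp
  have heven : Summable (fun k : ℕ => 1 / (((2 * k : ℕ) : ℝ) + 1) ^ s) :=
    hZ.summable.comp_injective (i := fun k : ℕ => 2 * k) (fun a b h => by simpa using h)
  have hE : ∑' k : ℕ, 1 / (((2 * k : ℕ) : ℝ) + 1) ^ s + 2 ^ (-s) * realZeta s = realZeta s :=
    (heven.hasSum.even_add_odd (f := fun k : ℕ => 1 / ((k : ℝ) + 1) ^ s) hodd).unique hZ
  have h2 : (2 : ℝ) ^ (1 - s) = 2 * 2 ^ (-s) := by
    rw [sub_eq_add_neg, Real.rpow_add (by norm_num), Real.rpow_one]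
  have : (1 - 2 ^ (1 - s)) * realZeta s =
      ∑' k : ℕ, 1 / (((2 * k : ℕ) : ℝ) + 1) ^ s + -(2 ^ (-s) * realZeta s) := by
    rw [h2]; linarith
  rw [this]
  refine HasSum.even_add_odd ?_ ?_
  · refine heven.hasSum.congr_fun fun k => ?_
    simp [pow_mul]
  · refine hodd.neg.congr_fun fun k => ?_
    rw [pow_succ, pow_mul]
    simp [neg_div]

theorem hasSum_log_one_add {u : ℝ} (hu : |u| < 1) :
    HasSum (fun k : ℕ => (-1) ^ k * u ^ (k + 1) / ((k : ℝ) + 1)) (Real.log (1 + u)) := by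
  have h := (Real.hasSum_pow_div_log_of_abs_lt_one (x := -u) (by rwa [abs_neg])).neg
  rw [neg_neg, sub_neg_eq_add] at h
  refine h.congr_fun fun k => ?_
  rw [neg_pow u, pow_succ (-1 : ℝ) k]
  ring

theorem log_one_add_exp_neg_le (y : ℝ) : Real.log (1 + Real.exp (-y)) ≤ Real.exp (-y) := by
  have := Real.log_le_sub_one_of_pos (by positivity : 0 < 1 + Real.exp (-y))
  linarith

theorem log_one_add_exp_neg_nonneg (y : ℝ) : 0 ≤ Real.log (1 + Real.exp (-y)) :=
  Real.log_nonneg (by linarith [Real.exp_pos (-y)])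

theorem exp_neg_le_two_mul_log {y : ℝ} (hy : 0 ≤ y) :
    Real.exp (-y) ≤ 2 * Real.log (1 + Real.exp (-y)) := by
  have h1 := Real.one_sub_inv_le_log_of_pos (by positivity : 0 < 1 + Real.exp (-y))
  have h2 : Real.exp (-y) ≤ 1 := Real.exp_le_one_iff.mpr (by linarith)
  have h3 := Real.exp_pos (-y)
  have h4 : Real.exp (-y) / 2 ≤ 1 - (1 + Real.exp (-y))⁻¹ := by
    rw [le_sub_iff_add_le, ← le_sub_iff_add_le', inv_le_iff_one_le_mul₀ (by positivity)]
    nlinarith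
  linarith

theorem integrableOn_log_one_add_exp_neg_rpow {κ : ℝ} (hκ : 0 < κ) :
    MeasureTheory.IntegrableOn (fun x : ℝ => Real.log (1 + Real.exp (-x ^ κ))) (Set.Ioi 0) := by
  refine MeasureTheory.Integrable.mono'
    (integrableOn_rpow_mul_exp_neg_rpow (s := 0) (p := κ) (by norm_num) hκ) ?_ ?_
  · refine Measurable.aestronglyMeasurable ?_
    fun_prop
  · refine Filter.Eventually.of_forall fun x => ?_
    rw [Real.norm_eq_abs, abs_of_nonneg (log_one_add_exp_neg_nonneg _)]
    simpa using log_one_add_exp_neg_le (x ^ κ)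

theorem integral_log_one_add_exp_neg_rpow {κ : ℝ} (hκ : 0 < κ) :
    ∫ x in Set.Ioi (0 : ℝ), Real.log (1 + Real.exp (-x ^ κ)) =
      Real.Gamma (1 / κ + 1) * ((1 - 2 ^ (-(1 / κ))) * realZeta (1 / κ + 1)) := by
  set F : ℕ → ℝ → ℝ := fun k x => (-1) ^ k * (Real.exp (-((k : ℝ) + 1) * x ^ κ) / ((k : ℝ) + 1))
  have hintg : ∀ k : ℕ, ∫ x in Set.Ioi (0 : ℝ), Real.exp (-((k : ℝ) + 1) * x ^ κ) / ((k : ℝ) + 1) =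
      Real.Gamma (1 / κ + 1) * (1 / ((k : ℝ) + 1) ^ (1 / κ + 1)) := by
    intro k
    rw [MeasureTheory.integral_div, integral_exp_neg_mul_rpow hκ (by positivity), neg_div,
      Real.rpow_neg (by positivity), Real.rpow_add (by positivity), Real.rpow_one]
    field_simp
  have hα : 1 < 1 / κ + 1 := by have : 0 < 1 / κ := by positivity
                                linarith
  have hFi : ∀ k, MeasureTheory.Integrable (F k)
      (MeasureTheory.volume.restrict (Set.Ioi (0 : ℝ))) := by
    intro k
    refine MeasureTheory.Integrable.const_mul (MeasureTheory.Integrable.div_const ?_ _) _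
    have := integrableOn_rpow_mul_exp_neg_mul_rpow (s := 0) (p := κ) (b := (k : ℝ) + 1)
      (by norm_num) hκ (by positivity)
    simpa only [Real.rpow_zero, one_mul, MeasureTheory.IntegrableOn] using this
  have hnorm : ∀ k x, ‖F k x‖ = Real.exp (-((k : ℝ) + 1) * x ^ κ) / ((k : ℝ) + 1) := by
    intro k x
    rw [Real.norm_eq_abs, abs_mul, abs_pow, abs_neg, abs_one, one_pow, one_mul,
      abs_of_pos (by positivity)]
  have hsum : Summable fun k => ∫ x in Set.Ioi (0 : ℝ), ‖F k x‖ := by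
    simp_rw [hnorm, hintg]
    exact (hasSum_realZeta hα).summable.mul_left _
  have h1 := MeasureTheory.hasSum_integral_of_summable_integral_norm hFi hsum
  have h2 : ∫ x in Set.Ioi (0 : ℝ), ∑' k, F k x =
      ∫ x in Set.Ioi (0 : ℝ), Real.log (1 + Real.exp (-x ^ κ)) := by
    refine MeasureTheory.setIntegral_congr_fun measurableSet_Ioi fun x hx => ?_
    have hx0 : 0 < x ^ κ := Real.rpow_pos_of_pos hx κ
    have := hasSum_log_one_add (u := Real.exp (-x ^ κ)) (by
      rw [abs_of_pos (Real.exp_pos _)]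
      exact Real.exp_lt_one_iff.mpr (by linarith))
    rw [← this.tsum_eq]
    refine tsum_congr fun k => ?_
    rw [← Real.exp_nat_mul, mul_div_assoc]
    push_cast
    simp only [F]
    ring_nf
  rw [h2] at h1
  refine h1.unique ?_
  have h3 := (hasSum_alternating_realZeta hα).mul_left (Real.Gamma (1 / κ + 1))
  rw [sub_add_cancel_right] at h3
  refine h3.congr_fun fun k => ?_
  simp only [F]
  rw [MeasureTheory.integral_const_mul, hintg]
  ring

theorem hasDerivAt_log_one_add_exp_neg_rpow {κ x : ℝ} (hx : 0 < x) :
    HasDerivAt (fun x : ℝ => Real.log (1 + Real.exp (-x ^ κ)))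
      (-(κ * x ^ (κ - 1) / (1 + Real.exp (x ^ κ)))) x := by
  have h1 := ((Real.hasDerivAt_rpow_const (p := κ) (Or.inl hx.ne')).neg.exp.const_add 1).log
    (by positivity)
  refine h1.congr_deriv ?_
  simp only [Pi.neg_apply]
  rw [Real.exp_neg]
  have := Real.exp_pos (x ^ κ)
  field_simp
  ring

theorem hasDerivAt_rpow_div_one_add_exp {κ x : ℝ} (hx : 0 < x) :
    HasDerivAt (fun x : ℝ => -(κ * x ^ (κ - 1) / (1 + Real.exp (x ^ κ))))
      (-((κ * ((κ - 1) * x ^ (κ - 1 - 1))) / (1 + Real.exp (x ^ κ)) -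
        (κ * x ^ (κ - 1)) ^ 2 * (Real.exp (x ^ κ) / (1 + Real.exp (x ^ κ)) ^ 2))) x := by
  have h1 := ((Real.hasDerivAt_rpow_const (p := κ - 1) (Or.inl hx.ne')).const_mul κ)
  have h2 := (Real.hasDerivAt_rpow_const (p := κ) (Or.inl hx.ne')).exp.const_add 1
  refine ((h1.div h2 (by positivity)).neg).congr_deriv ?_
  have := Real.exp_pos (x ^ κ)
  field_simp

theorem le_psPart {κ : ℝ} (hκ : 1 ≤ κ) (l : ℕ) : l ≤ psPart κ l := by
  rcases Nat.eq_zero_or_pos l with rfl | hl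
  · exact Nat.zero_le _
  · exact Nat.le_floor (Real.self_le_rpow_of_one_le (by exact_mod_cast hl) hκ)

theorem hasSum_exp_neg_mul_add {s : ℝ} (hs : 0 < s) (n : ℕ) :
    HasSum (fun l : ℕ => Real.exp (-(s * ((n + l + 1 : ℕ) : ℝ))))
      (Real.exp (-(s * n)) / (Real.exp s - 1)) := by
  have h1 := (hasSum_geometric_of_lt_one (Real.exp_pos (-s)).le
    (Real.exp_lt_one_iff.mpr (by linarith))).mul_left (Real.exp (-(s * (n + 1 : ℕ))))
  have h2 : Real.exp (-(s * n)) / (Real.exp s - 1) =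
      Real.exp (-(s * (n + 1 : ℕ))) * (1 - Real.exp (-s))⁻¹ := by
    have h3 : Real.exp s - 1 ≠ 0 := by linarith [Real.add_one_lt_exp hs.ne']
    have h4 : Real.exp (-(s * (n + 1 : ℕ))) = Real.exp (-(s * n)) * (Real.exp s)⁻¹ := by
      rw [← Real.exp_neg, ← Real.exp_add]; push_cast; ring_nf
    rw [h4, Real.exp_neg s]
    have h5 : 1 - (Real.exp s)⁻¹ = (Real.exp s - 1) / Real.exp s := by field_simp
    rw [h5]
    field_simp
  rw [h2]
  refine h1.congr_fun fun l => ?_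
  rw [← Real.exp_nat_mul, ← Real.exp_add]
  push_cast
  ring_nf

theorem exp_neg_mul_psPart_le {κ s : ℝ} (hκ : 1 ≤ κ) (hs : 0 < s) (l : ℕ) :
    Real.exp (-(s * psPart κ l)) ≤ Real.exp (-(s * l)) := by
  have : (l : ℝ) ≤ psPart κ l := by exact_mod_cast le_psPart hκ l
  gcongr

theorem summable_exp_neg_mul_psPart {κ s : ℝ} (hκ : 1 ≤ κ) (hs : 0 < s) :
    Summable fun l : ℕ => Real.exp (-(s * psPart κ (l + 1))) := by
  have h := (hasSum_exp_neg_mul_add hs 0).summable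
  simp only [zero_add] at h
  exact h.of_nonneg_of_le (fun _ => (Real.exp_pos _).le) fun l => exp_neg_mul_psPart_le hκ hs _

theorem summable_log_one_add_exp_neg_mul_psPart {κ s : ℝ} (hκ : 1 ≤ κ) (hs : 0 < s) :
    Summable fun l : ℕ => Real.log (1 + Real.exp (-(s * psPart κ (l + 1)))) :=
  (summable_exp_neg_mul_psPart hκ hs).of_nonneg_of_le (fun _ => log_one_add_exp_neg_nonneg _)
    fun _ => log_one_add_exp_neg_le _

theorem exists_abs_tsum_log_one_add_exp_sub_le {κ : ℝ} (hκ : 1 < κ) :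
    ∃ C, ∀ t > 0, |(∑' l : ℕ, Real.log (1 + Real.exp (-(t * (l + 1 : ℕ)) ^ κ))) + Real.log 2 / 2 -
      t⁻¹ * ∫ x in Set.Ioi (0 : ℝ), Real.log (1 + Real.exp (-x ^ κ))| ≤ t * C := by
  have hκ0 : 0 < κ := by linarith
  set m : ℝ → ℝ := fun x => κ * (κ - 1) * (x ^ (κ - 1 - 1) * Real.exp (-x ^ κ)) +
    κ ^ 2 * (x ^ (2 * (κ - 1)) * Real.exp (-x ^ κ))
  have hmi : MeasureTheory.IntegrableOn m (Set.Ioi 0) :=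
    ((integrableOn_rpow_mul_exp_neg_rpow (by linarith) hκ0).const_mul _).add
      ((integrableOn_rpow_mul_exp_neg_rpow (by linarith) hκ0).const_mul _)
  refine ⟨∫ x in Set.Ioi 0, m x, fun t ht => ?_⟩
  have hbound := abs_sum_sub_integral_le (m := m) ht
    (g := fun x : ℝ => Real.log (1 + Real.exp (-x ^ κ)))
    (Continuous.continuousOn (by
      refine Continuous.log ?_ fun x => by positivity
      have := Real.continuous_rpow_const hκ0.le
      fun_prop))
    (Continuous.continuousOn (by
      have h1 := Real.continuous_rpow_const hκ0.le
      have h2 := Real.continuous_rpow_const (sub_pos.mpr hκ).le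
      exact ((continuous_const.mul h2).div (by fun_prop) fun x => by positivity).neg))
    (fun x hx => hasDerivAt_log_one_add_exp_neg_rpow hx)
    (fun x hx => hasDerivAt_rpow_div_one_add_exp hx) (by
      intro x hx
      have hE := Real.exp_pos (x ^ κ)
      have hκ1 : 0 < κ - 1 := by linarith
      have h1 : 1 / (1 + Real.exp (x ^ κ)) ≤ Real.exp (-x ^ κ) := by
        rw [Real.exp_neg, ← one_div]
        exact one_div_le_one_div_of_le hE (by linarith)
      have h2 : Real.exp (x ^ κ) / (1 + Real.exp (x ^ κ)) ^ 2 ≤ Real.exp (-x ^ κ) := by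
        rw [Real.exp_neg, ← one_div, div_le_div_iff₀ (by positivity) hE]
        nlinarith
      have h3 : (x ^ (κ - 1)) ^ 2 = x ^ (2 * (κ - 1)) := by
        rw [mul_comm 2, Real.rpow_mul (le_of_lt hx), Real.rpow_two]
      rw [abs_neg]
      refine (abs_sub _ _).trans ?_
      rw [abs_of_nonneg (by have := Real.rpow_pos_of_pos hx (κ - 1 - 1); positivity),
        abs_of_nonneg (by positivity), mul_pow, h3, div_eq_mul_one_div]
      have hx1 := Real.rpow_pos_of_pos hx (κ - 1 - 1)
      have hx2 := Real.rpow_pos_of_pos hx (2 * (κ - 1))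
      calc _ ≤ κ * ((κ - 1) * x ^ (κ - 1 - 1)) * Real.exp (-x ^ κ) +
            κ ^ 2 * x ^ (2 * (κ - 1)) * Real.exp (-x ^ κ) := by gcongr
        _ = m x := by simp only [m]; ring) hmi
  have hsummable : Summable fun l : ℕ => Real.log (1 + Real.exp (-(t * (l + 1 : ℕ)) ^ κ)) := by
    have h1 : Summable fun l : ℕ => Real.exp (((l + 1 : ℕ) : ℝ) * -(t ^ κ)) :=
      (summable_nat_add_iff 1).mpr (Real.summable_exp_nat_mul_iff.mpr
        (by have := Real.rpow_pos_of_pos ht κ; linarith))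
    refine h1.of_nonneg_of_le (fun l => log_one_add_exp_neg_nonneg _) fun l => ?_
    refine (log_one_add_exp_neg_le _).trans (Real.exp_le_exp.mpr ?_)
    rw [Real.mul_rpow ht.le (by positivity)]
    have h2 : ((l + 1 : ℕ) : ℝ) ≤ ((l + 1 : ℕ) : ℝ) ^ κ :=
      Real.self_le_rpow_of_one_le (by push_cast; linarith [(Nat.cast_nonneg l : (0 : ℝ) ≤ l)]) hκ.le
    have := Real.rpow_pos_of_pos ht κ
    nlinarith
  have hgt : Tendsto (fun n : ℕ => t * (n : ℝ)) atTop atTop :=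
    tendsto_natCast_atTop_atTop.const_mul_atTop ht
  have hg0 : Tendsto (fun n : ℕ => Real.log (1 + Real.exp (-(t * (n : ℝ)) ^ κ))) atTop (𝓝 0) := by
    have h1 : Tendsto (fun n : ℕ => Real.exp (-(t * (n : ℝ)) ^ κ)) atTop (𝓝 0) :=
      Real.tendsto_exp_neg_atTop_nhds_zero.comp ((tendsto_rpow_atTop hκ0).comp hgt)
    exact squeeze_zero (fun n => log_one_add_exp_neg_nonneg _)
      (fun n => log_one_add_exp_neg_le _) h1
  have hlim := ((hsummable.hasSum.tendsto_sum_nat.add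
    ((tendsto_const_nhds (x := Real.log 2)).sub hg0 |>.div_const 2)).sub
    ((MeasureTheory.intervalIntegral_tendsto_integral_Ioi 0
      (integrableOn_log_one_add_exp_neg_rpow hκ0) hgt).const_mul t⁻¹)).abs
  rw [sub_zero] at hlim
  refine le_of_tendsto hlim (Filter.Eventually.of_forall fun n => ?_)
  have h := hbound n
  simp only [Real.zero_rpow hκ0.ne', neg_zero, Real.exp_zero] at h
  norm_num at h ⊢
  exact h

/-- Logarithm of the generating product `∏ (1 + e^{-s ⌊ℓ^κ⌋})`. -/
noncomputable def logProd (κ s : ℝ) : ℝ :=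
  ∑' l : ℕ, Real.log (1 + Real.exp (-(s * psPart κ (l + 1))))

theorem log_one_add_exp_neg_sub_le {s a b : ℝ} (hs : 0 < s) (ha : 0 ≤ a) (hab : a ≤ b)
    (hba : b ≤ a + 1) :
    Real.log (1 + Real.exp (-(s * a))) - Real.log (1 + Real.exp (-(s * b))) ≤
      2 * s * Real.exp s * Real.log (1 + Real.exp (-(s * b))) := by
  have h1 : Real.log (1 + Real.exp (-(s * a))) - Real.log (1 + Real.exp (-(s * b))) ≤
      Real.exp (-(s * a)) - Real.exp (-(s * b)) := by
    rw [← Real.log_div (by positivity) (by positivity)]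
    refine (Real.log_le_sub_one_of_pos (by positivity)).trans ?_
    rw [div_sub_one (by positivity), add_sub_add_left_eq_sub]
    refine div_le_self (sub_nonneg.mpr (Real.exp_le_exp.mpr (by nlinarith))) ?_
    linarith [Real.exp_pos (-(s * b))]
  have h2 : Real.exp (-(s * a)) - Real.exp (-(s * b)) ≤ s * Real.exp (-(s * a)) := by
    have h3 : Real.exp (-(s * b)) = Real.exp (-(s * a)) * Real.exp (-(s * (b - a))) := by
      rw [← Real.exp_add]; ring_nf
    have h4 := Real.add_one_le_exp (-(s * (b - a)))
    have h5 : 1 - Real.exp (-(s * (b - a))) ≤ s := by nlinarith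
    rw [h3]
    nlinarith [Real.exp_pos (-(s * a))]
  have h6 : Real.exp (-(s * a)) ≤ Real.exp s * Real.exp (-(s * b)) := by
    rw [← Real.exp_add]
    exact Real.exp_le_exp.mpr (by nlinarith)
  have h7 := exp_neg_le_two_mul_log (y := s * b) (by positivity [ha.trans hab])
  calc _ ≤ s * Real.exp (-(s * a)) := h1.trans h2
    _ ≤ s * (Real.exp s * (2 * Real.log (1 + Real.exp (-(s * b))))) := by
        gcongr; exact h6.trans (by gcongr)
    _ = _ := by ring

theorem tendsto_logProd_sub {κ : ℝ} (hκ : 1 < κ) :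
    Tendsto (fun s => logProd κ s - Real.Gamma (1 / κ + 1) *
      ((1 - 2 ^ (-(1 / κ))) * realZeta (1 / κ + 1)) * s ^ (-(1 / κ)) + Real.log 2 / 2)
      (𝓝[>] 0) (𝓝 0) := by
  have hκ0 : 0 < κ := by linarith
  obtain ⟨C, hC⟩ := exists_abs_tsum_log_one_add_exp_sub_le hκ
  rw [integral_log_one_add_exp_neg_rpow hκ0] at hC
  set A := Real.Gamma (1 / κ + 1) * ((1 - 2 ^ (-(1 / κ))) * realZeta (1 / κ + 1))
  set α := 1 / κ with hα
  have hα0 : 0 < α := by positivity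
  have hα1 : α < 1 := by rw [hα, div_lt_one hκ0]; exact hκ
  set G : ℝ → ℝ := fun s => ∑' l : ℕ, Real.log (1 + Real.exp (-(s * ((l + 1 : ℕ) : ℝ) ^ κ)))
  have hG : ∀ s > 0, |G s + Real.log 2 / 2 - A * s ^ (-α)| ≤ s ^ α * C := by
    intro s hs
    have h := hC (s ^ α) (Real.rpow_pos_of_pos hs α)
    have h1 : ∀ l : ℕ, -(s ^ α * ((l + 1 : ℕ) : ℝ)) ^ κ = -(s * ((l + 1 : ℕ) : ℝ) ^ κ) := by
      intro l
      rw [Real.mul_rpow (by positivity) (by positivity), ← Real.rpow_mul hs.le, hα,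
        one_div_mul_cancel hκ0.ne', Real.rpow_one]
    simp_rw [h1] at h
    rwa [← Real.rpow_neg hs.le, mul_comm (s ^ (-α))] at h
  have hGs : ∀ s > 0, Summable fun l : ℕ =>
      Real.log (1 + Real.exp (-(s * ((l + 1 : ℕ) : ℝ) ^ κ))) := by
    intro s hs
    refine (summable_exp_neg_mul_psPart hκ.le hs).of_nonneg_of_le
      (fun _ => log_one_add_exp_neg_nonneg _) fun l => ?_
    refine (log_one_add_exp_neg_le _).trans (Real.exp_le_exp.mpr ?_)
    have := psPart_le_rpow κ (l + 1)
    nlinarith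
  have hL : ∀ s > 0, |logProd κ s - G s| ≤ 2 * s * Real.exp s * G s := by
    intro s hs
    have h1 := summable_log_one_add_exp_neg_mul_psPart hκ.le hs
    rw [logProd, ← (h1.tsum_sub (hGs s hs)), ← tsum_mul_left, abs_of_nonneg]
    · refine (h1.sub (hGs s hs)).tsum_le_tsum (fun l => ?_) ((hGs s hs).mul_left _)
      exact log_one_add_exp_neg_sub_le hs (by positivity) (psPart_le_rpow κ (l + 1))
        (rpow_lt_psPart_add_one κ (l + 1)).le
    · refine tsum_nonneg fun l => sub_nonneg.mpr ?_
      have := psPart_le_rpow κ (l + 1)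
      gcongr
  have hs0 : Tendsto (fun s : ℝ => s) (𝓝[>] 0) (𝓝 0) := nhdsWithin_le_nhds
  have hpow : ∀ e : ℝ, 0 < e → Tendsto (fun s : ℝ => s ^ e) (𝓝[>] 0) (𝓝 0) := by
    intro e he
    have := (Real.continuous_rpow_const he.le).tendsto 0
    rw [Real.zero_rpow he.ne'] at this
    exact this.mono_left nhdsWithin_le_nhds
  have hlim : Tendsto (fun s : ℝ => s ^ α * C + 2 * Real.exp s *
      (s * (s ^ α * C) + |A| * s ^ (1 - α) + s * |Real.log 2 / 2|)) (𝓝[>] 0) (𝓝 0) := by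
    have h1 := ((hpow α hα0).mul_const C).add
      ((((Real.continuous_exp.tendsto 0).mono_left (nhdsWithin_le_nhds (s := Set.Ioi 0))).const_mul 2).mul
        (((hs0.mul ((hpow α hα0).mul_const C)).add ((hpow (1 - α) (by linarith)).const_mul |A|)).add
          (hs0.mul_const |Real.log 2 / 2|)))
    simpa using h1
  refine squeeze_zero_norm' ?_ hlim
  filter_upwards [self_mem_nhdsWithin] with s hs
  have hs : 0 < s := hs
  have h1 := hG s hs
  have h2 := hL s hs
  have h3 : G s ≤ s ^ α * C + |A| * s ^ (-α) + |Real.log 2 / 2| := by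
    have h4 := (abs_le.mp h1).2
    have h5 : A * s ^ (-α) ≤ |A| * s ^ (-α) := by gcongr; exact le_abs_self A
    linarith [neg_le_abs (Real.log 2 / 2)]
  have h6 : s * s ^ (-α) = s ^ (1 - α) := by
    rw [sub_eq_add_neg, Real.rpow_add hs, Real.rpow_one]
  rw [Real.norm_eq_abs]
  calc |logProd κ s - A * s ^ (-α) + Real.log 2 / 2|
      = |(G s + Real.log 2 / 2 - A * s ^ (-α)) + (logProd κ s - G s)| := by ring_nf
    _ ≤ _ := abs_add_le _ _
    _ ≤ s ^ α * C + 2 * s * Real.exp s * (s ^ α * C + |A| * s ^ (-α) + |Real.log 2 / 2|) :=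
        add_le_add h1 (h2.trans (by gcongr))
    _ = _ := by rw [← h6]; ring

theorem logProd_sub_sum_mem_Icc {κ s : ℝ} (hκ : 1 ≤ κ) (hs : 0 < s) (n : ℕ) :
    logProd κ s - ∑ l ∈ Finset.range n, Real.log (1 + Real.exp (-(s * psPart κ (l + 1)))) ∈
      Set.Icc 0 (Real.exp (-(s * n)) / s) := by
  have h1 := summable_log_one_add_exp_neg_mul_psPart hκ hs
  rw [logProd, ← h1.sum_add_tsum_nat_add n, add_sub_cancel_left]
  refine ⟨tsum_nonneg fun _ => log_one_add_exp_neg_nonneg _, ?_⟩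
  have h2 := hasSum_exp_neg_mul_add hs n
  calc _ ≤ ∑' l : ℕ, Real.exp (-(s * ((n + l + 1 : ℕ) : ℝ))) := by
        refine ((summable_nat_add_iff n).mpr h1).tsum_le_tsum (fun l => ?_) h2.summable
        refine (log_one_add_exp_neg_le _).trans ?_
        rw [add_comm l n]
        exact exp_neg_mul_psPart_le hκ hs _
    _ = _ := h2.tsum_eq
    _ ≤ _ := by
        gcongr
        linarith [Real.add_one_le_exp s]

theorem qk_eq_card {κ : ℝ} (hκ : 1 ≤ κ) (n : ℕ) :
    qk κ n = ((Finset.range n).powerset.filter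
      fun t => ∑ l ∈ t, psPart κ (l + 1) = n).card := by
  have hsupp : ∀ r : ℕ →₀ ℕ, (∀ l, r l ≤ 1) →
      (r.sum fun l j => j * psPart κ (l + 1)) = ∑ l ∈ r.support, psPart κ (l + 1) := by
    intro r hr
    refine Finset.sum_congr rfl fun l hl => ?_
    have h1 := hr l
    have h2 := Finsupp.mem_support_iff.mp hl
    simp [show r l = 1 by omega]
  rw [qk, ← Nat.card_eq_finsetCard]
  refine Nat.card_eq_of_bijective (fun r => ⟨r.1.support, ?_⟩) ⟨?_, ?_⟩
  · obtain ⟨r, hr, hrn⟩ := r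
    rw [hsupp r hr] at hrn
    refine Finset.mem_filter.mpr ⟨Finset.mem_powerset.mpr fun l hl => ?_, hrn⟩
    have h1 := le_psPart hκ (l + 1)
    have h2 : psPart κ (l + 1) ≤ n :=
      hrn ▸ Finset.single_le_sum (f := fun l => psPart κ (l + 1)) (fun _ _ => Nat.zero_le _) hl
    exact Finset.mem_range.mpr (by omega)
  · rintro ⟨r, hr, hrn⟩ ⟨s, hs, hsn⟩ h
    have h' : r.support = s.support := congrArg Subtype.val h
    refine Subtype.ext (Finsupp.ext fun l => ?_)
    have h1 := hr l
    have h2 := hs l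
    have h3 : r l ≠ 0 ↔ s l ≠ 0 := by
      rw [← Finsupp.mem_support_iff, ← Finsupp.mem_support_iff, h']
    change r l = s l
    omega
  · rintro ⟨t, ht⟩
    obtain ⟨-, htn⟩ := Finset.mem_filter.mp ht
    set r : ℕ →₀ ℕ := Finsupp.onFinset t (fun l => if l ∈ t then 1 else 0) (by simp)
    have hr : ∀ l, r l ≤ 1 := by
      intro l
      simp only [r, Finsupp.onFinset_apply]
      split_ifs <;> simp
    have hrt : r.support = t := by
      ext l
      simp [r]
    exact ⟨⟨r, hr, by rw [hsupp r hr, hrt, htn]⟩, Subtype.ext hrt⟩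

theorem integral_exp_int_mul_I (k : ℤ) :
    ∫ θ in (-π)..π, Complex.exp (k * θ * Complex.I) =
      ((if k = 0 then 2 * π else 0 : ℝ) : ℂ) := by
  split_ifs with hk
  · subst hk
    simp
    ring
  · have hc : (k : ℂ) * Complex.I ≠ 0 := by simp [hk]
    have h1 : ∀ θ : ℝ, Complex.exp (k * θ * Complex.I) = Complex.exp ((k * Complex.I) * θ) := by
      intro θ; ring_nf
    simp_rw [h1]
    rw [integral_exp_mul_complex hc]
    have h2 : Complex.exp (k * Complex.I * (π : ℝ)) = Complex.exp (k * Complex.I * (-π : ℝ)) := by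
      rw [Complex.exp_eq_exp_iff_exists_int]
      exact ⟨k, by push_cast; ring⟩
    rw [h2, sub_self, zero_div, Complex.ofReal_zero]

theorem integral_prod_one_add_exp (a : ℕ → ℕ) (ρ : ℝ) (N n : ℕ) :
    ∫ θ in (-π)..π, (∏ l ∈ Finset.range N, (1 + Complex.exp ((-ρ + θ * Complex.I) * a l))) *
      Complex.exp (-(n * θ * Complex.I)) =
    2 * π * Real.exp (-(ρ * n)) *
      (((Finset.range N).powerset.filter fun t => ∑ l ∈ t, a l = n).card : ℂ) := by
  have h1 : ∀ θ : ℝ, (∏ l ∈ Finset.range N, (1 + Complex.exp ((-ρ + θ * Complex.I) * a l))) *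
      Complex.exp (-(n * θ * Complex.I)) = ∑ t ∈ (Finset.range N).powerset,
        Complex.exp (-(ρ * (∑ l ∈ t, a l : ℕ))) *
          Complex.exp (((∑ l ∈ t, a l : ℕ) - n : ℤ) * θ * Complex.I) := by
    intro θ
    rw [Finset.prod_one_add, Finset.sum_mul]
    refine Finset.sum_congr rfl fun t _ => ?_
    rw [← Complex.exp_sum, ← Complex.exp_add, ← Complex.exp_add, ← Finset.mul_sum]
    push_cast
    ring_nf
  simp_rw [h1]
  rw [intervalIntegral.integral_finsetSum
    fun t _ => Continuous.intervalIntegrable (by fun_prop) _ _]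
  simp_rw [intervalIntegral.integral_const_mul, integral_exp_int_mul_I]
  rw [Finset.card_filter, Nat.cast_sum, Finset.mul_sum]
  refine Finset.sum_congr rfl fun t _ => ?_
  by_cases h : ∑ l ∈ t, a l = n
  · simp [h, mul_comm]
  · have h' : ((∑ l ∈ t, a l : ℕ) - n : ℤ) ≠ 0 := by
      rw [sub_ne_zero]; exact_mod_cast h
    simp only [h, h', if_false]
    simp

theorem norm_prod_sub_prod_le_sum {ι : Type*} (s : Finset ι) {f g : ι → ℂ}
    (hf : ∀ i, ‖f i‖ ≤ 1) (hg : ∀ i, ‖g i‖ ≤ 1) :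
    ‖∏ i ∈ s, f i - ∏ i ∈ s, g i‖ ≤ ∑ i ∈ s, ‖f i - g i‖ := by
  classical
  induction s using Finset.induction_on with
  | empty => simp
  | insert i s hi ih =>
    rw [Finset.prod_insert hi, Finset.prod_insert hi, Finset.sum_insert hi]
    have h1 : ‖∏ j ∈ s, g j‖ ≤ 1 := by
      rw [norm_prod]
      exact Finset.prod_le_one (fun _ _ => norm_nonneg _) fun j _ => hg j
    calc _ = ‖f i * (∏ j ∈ s, f j - ∏ j ∈ s, g j) + (f i - g i) * ∏ j ∈ s, g j‖ := by ring_nf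
      _ ≤ ‖f i‖ * ‖∏ j ∈ s, f j - ∏ j ∈ s, g j‖ + ‖f i - g i‖ * ‖∏ j ∈ s, g j‖ := by
          rw [← norm_mul, ← norm_mul]; exact norm_add_le _ _
      _ ≤ 1 * ∑ j ∈ s, ‖f j - g j‖ + ‖f i - g i‖ * 1 := by gcongr; exact hf i
      _ = _ := by ring

theorem norm_exp_mul_I_sub_le (y : ℝ) :
    ‖Complex.exp (y * Complex.I) - (1 + y * Complex.I - y ^ 2 / 2)‖ ≤ 4 * |y| ^ 3 := by
  rcases le_or_gt |y| 1 with hy | hy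
  · have h := Complex.exp_bound (x := y * Complex.I) (by simpa using hy) (n := 3) (by norm_num)
    have h1 : ∑ m ∈ Finset.range 3, (y * Complex.I) ^ m / (m.factorial : ℂ) =
        1 + y * Complex.I - y ^ 2 / 2 := by
      simp [Finset.sum_range_succ, mul_pow, Nat.factorial]
      ring
    rw [h1] at h
    refine h.trans ?_
    simp [Nat.factorial]
    nlinarith [pow_nonneg (abs_nonneg y) 3]
  · have h1 : ‖(1 + y * Complex.I - y ^ 2 / 2 : ℂ)‖ ≤ 1 + |y| + |y| ^ 2 / 2 := by
      refine le_trans (norm_sub_le _ _) <| add_le_add ((norm_add_le _ _).trans ?_) ?_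
      · simp
      · simp
    have h2 := norm_sub_le (Complex.exp (y * Complex.I)) (1 + y * Complex.I - y ^ 2 / 2)
    rw [Complex.norm_exp_ofReal_mul_I] at h2
    have h3 : |y| ≤ |y| ^ 3 := le_self_pow₀ hy.le (by norm_num)
    have h4 : |y| ^ 2 ≤ |y| ^ 3 := pow_le_pow_right₀ hy.le (by norm_num)
    linarith

theorem norm_one_sub_add_mul_exp_le (p v : ℝ) :
    ‖(1 - p + p * Complex.exp (v * Complex.I) : ℂ)‖ ≤
      Real.exp (-(p * (1 - p) * (1 - Real.cos v))) := by
  have h1 : ‖(1 - p + p * Complex.exp (v * Complex.I) : ℂ)‖ ^ 2 =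
      1 - 2 * (p * (1 - p) * (1 - Real.cos v)) := by
    rw [← Complex.normSq_eq_norm_sq, Complex.normSq_apply]
    simp only [Complex.add_re, Complex.sub_re, Complex.one_re, Complex.ofReal_re, Complex.mul_re,
      Complex.exp_ofReal_mul_I_re, Complex.ofReal_im, Complex.exp_ofReal_mul_I_im, zero_mul,
      sub_zero, Complex.add_im, Complex.sub_im, Complex.one_im, Complex.mul_im, add_zero]
    linear_combination p ^ 2 * Real.sin_sq_add_cos_sq v
  refine (sq_le_sq₀ (norm_nonneg _) (Real.exp_pos _).le).mp ?_
  rw [h1, ← Real.exp_nat_mul]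
  have := Real.add_one_le_exp (-(2 * (p * (1 - p) * (1 - Real.cos v))))
  push_cast
  rw [mul_neg]
  linarith

theorem norm_bernoulli_sub_gaussian_le {p : ℝ} (hp : 0 ≤ p) (hp1 : p ≤ 1) (v : ℝ) :
    ‖(1 - p + p * Complex.exp (v * Complex.I)) * Complex.exp (-(p * v * Complex.I)) -
      Real.exp (-(p * (1 - p) * v ^ 2 / 2))‖ ≤ 5 * (p * |v| ^ 3) := by
  have hv : 0 ≤ |v| ^ 3 := by positivity
  have hpq : 0 ≤ p * (1 - p) := mul_nonneg hp (by linarith)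
  set E : ℝ → ℂ := fun y => Complex.exp (y * Complex.I) - (1 + y * Complex.I - y ^ 2 / 2)
  have h1 : (1 - p + p * Complex.exp (v * Complex.I)) * Complex.exp (-(p * v * Complex.I)) =
      ((1 - p * (1 - p) * v ^ 2 / 2 : ℝ) : ℂ) +
        ((1 - p : ℝ) * E (-(p * v)) + (p : ℝ) * E ((1 - p) * v)) := by
    have h2 : Complex.exp (((1 - p) * v : ℝ) * Complex.I) =
        Complex.exp (v * Complex.I) * Complex.exp (-(p * v * Complex.I)) := by
      rw [← Complex.exp_add]; push_cast; ring_nf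
    have h3 : Complex.exp (((-(p * v) : ℝ)) * Complex.I) = Complex.exp (-(p * v * Complex.I)) := by
      push_cast; ring_nf
    simp only [E]
    rw [h2, h3]
    push_cast
    ring
  have h4 : ‖((1 - p : ℝ) * E (-(p * v)) + (p : ℝ) * E ((1 - p) * v) : ℂ)‖ ≤ 4 * (p * |v| ^ 3) := by
    refine (norm_add_le _ _).trans ?_
    rw [norm_mul, norm_mul, Complex.norm_real, Complex.norm_real, Real.norm_eq_abs,
      Real.norm_eq_abs, abs_of_nonneg hp, abs_of_nonneg (by linarith : 0 ≤ 1 - p)]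
    have h5 := norm_exp_mul_I_sub_le (-(p * v))
    have h6 := norm_exp_mul_I_sub_le ((1 - p) * v)
    rw [abs_neg, abs_mul, abs_of_nonneg hp, mul_pow] at h5
    rw [abs_mul, abs_of_nonneg (by linarith : 0 ≤ 1 - p), mul_pow] at h6
    calc _ ≤ (1 - p) * (4 * (p ^ 3 * |v| ^ 3)) + p * (4 * ((1 - p) ^ 3 * |v| ^ 3)) := by
          have : 0 ≤ 1 - p := by linarith
          gcongr
      _ = 4 * (p * |v| ^ 3) * (1 - p * (3 - 4 * p + 2 * p ^ 2)) := by ring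
      _ ≤ 4 * (p * |v| ^ 3) * 1 := by
          gcongr
          nlinarith [sq_nonneg (p - 1), mul_nonneg hp (by nlinarith [sq_nonneg (p - 1)] :
            0 ≤ 3 - 4 * p + 2 * p ^ 2)]
      _ = _ := mul_one _
  set w := p * (1 - p) * v ^ 2 / 2 with hw
  have hw0 : 0 ≤ w := by positivity
  have h7 : |(1 - w) - Real.exp (-w)| ≤ p * |v| ^ 3 := by
    have h8 := Real.add_one_le_exp (-w)
    rw [abs_sub_comm, abs_of_nonneg (by linarith)]
    have hwv : w ≤ p * |v| ^ 2 := by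
      rw [hw, sq_abs]
      nlinarith [mul_nonneg (mul_nonneg hp hp) (sq_nonneg v), mul_nonneg hp (sq_nonneg v)]
    rcases le_or_gt |v| 1 with hv1 | hv1
    · have hw1 : w ≤ 1 := by
        have : |v| ^ 2 ≤ 1 := pow_le_one₀ (abs_nonneg _) hv1
        nlinarith
      have h9 := Real.norm_exp_sub_one_sub_id_le (x := -w)
        (by rw [Real.norm_eq_abs, abs_neg, abs_of_nonneg hw0]; exact hw1)
      rw [Real.norm_eq_abs, Real.norm_eq_abs, sq_abs, neg_sq] at h9
      have h10 := (abs_le.mp h9).2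
      have h11 : w ^ 2 ≤ p * |v| ^ 3 := by
        calc w ^ 2 ≤ (p * |v| ^ 2) ^ 2 := by gcongr
          _ = (p * p) * (|v| ^ 3 * |v|) := by ring
          _ ≤ (p * 1) * (|v| ^ 3 * 1) := by gcongr
          _ = _ := by ring
      linarith
    · have h9 : Real.exp (-w) ≤ 1 := Real.exp_le_one_iff.mpr (by linarith)
      have h10 : p * |v| ^ 2 ≤ p * |v| ^ 3 := by
        gcongr
        · exact hv1.le
        · norm_num
      linarith
  rw [h1]
  calc _ = ‖(((1 - w) - Real.exp (-w) : ℝ) : ℂ) +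
        ((1 - p : ℝ) * E (-(p * v)) + (p : ℝ) * E ((1 - p) * v))‖ := by
        congr 1; push_cast; ring
    _ ≤ _ := norm_add_le _ _
    _ ≤ p * |v| ^ 3 + 4 * (p * |v| ^ 3) := by
        rw [Complex.norm_real, Real.norm_eq_abs]; exact add_le_add h7 h4
    _ = _ := by ring

theorem norm_prod_bernoulli_sub_gaussian_le {p : ℕ → ℝ} (hp : ∀ l, 0 ≤ p l) (hp1 : ∀ l, p l ≤ 1)
    (a : ℕ → ℝ) (θ ν : ℝ) (N : ℕ) :
    ‖(∏ l ∈ Finset.range N, (1 - p l + p l * Complex.exp ((θ * a l : ℝ) * Complex.I))) *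
        Complex.exp (-(ν * θ * Complex.I)) -
      Complex.exp ((((∑ l ∈ Finset.range N, a l * p l) - ν) * θ : ℝ) * Complex.I) *
        Real.exp (-((∑ l ∈ Finset.range N, a l ^ 2 * (p l * (1 - p l))) * θ ^ 2 / 2))‖ ≤
      5 * |θ| ^ 3 * ∑ l ∈ Finset.range N, |a l| ^ 3 * p l := by
  set f : ℕ → ℂ := fun l => (1 - p l + p l * Complex.exp ((θ * a l : ℝ) * Complex.I)) *
    Complex.exp (-(p l * (θ * a l : ℝ) * Complex.I))
  set g : ℕ → ℂ := fun l => Real.exp (-(p l * (1 - p l) * (θ * a l) ^ 2 / 2))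
  have hf : ∀ l, ‖f l‖ ≤ 1 := by
    intro l
    have h2 : Complex.exp (-(p l * (θ * a l : ℝ) * Complex.I)) =
        Complex.exp (((-(p l * (θ * a l)) : ℝ) : ℂ) * Complex.I) := by push_cast; ring_nf
    simp only [f]
    rw [norm_mul, h2, Complex.norm_exp_ofReal_mul_I, mul_one]
    refine (norm_one_sub_add_mul_exp_le _ _).trans (Real.exp_le_one_iff.mpr ?_)
    have := Real.cos_le_one (θ * a l)
    have := mul_nonneg (hp l) (sub_nonneg.mpr (hp1 l))
    nlinarith
  have hg : ∀ l, ‖g l‖ ≤ 1 := by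
    intro l
    simp only [g]
    rw [Complex.norm_real, Real.norm_eq_abs, abs_of_pos (Real.exp_pos _), Real.exp_le_one_iff]
    have := mul_nonneg (hp l) (sub_nonneg.mpr (hp1 l))
    have := mul_nonneg this (sq_nonneg (θ * a l))
    linarith
  have h1 := norm_prod_sub_prod_le_sum (Finset.range N) hf hg
  have h2 : ∏ l ∈ Finset.range N, g l =
      Real.exp (-((∑ l ∈ Finset.range N, a l ^ 2 * (p l * (1 - p l))) * θ ^ 2 / 2)) := by
    simp only [g]
    rw [← Complex.ofReal_prod, ← Real.exp_sum, Finset.sum_mul, Finset.sum_div,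
      ← Finset.sum_neg_distrib]
    congr 2
    exact Finset.sum_congr rfl fun l _ => by ring
  have h3 : (∏ l ∈ Finset.range N, (1 - p l + p l * Complex.exp ((θ * a l : ℝ) * Complex.I))) *
        Complex.exp (-(ν * θ * Complex.I)) = (∏ l ∈ Finset.range N, f l) *
      Complex.exp ((((∑ l ∈ Finset.range N, a l * p l) - ν) * θ : ℝ) * Complex.I) := by
    simp only [f]
    have h4 : ∑ l ∈ Finset.range N, -(p l * (θ * a l : ℝ) * Complex.I : ℂ) =
        -((∑ l ∈ Finset.range N, a l * p l : ℝ) * θ * Complex.I) := by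
      push_cast
      rw [Finset.sum_neg_distrib, Finset.sum_mul, Finset.sum_mul]
      exact congrArg _ (Finset.sum_congr rfl fun l _ => by ring)
    rw [Finset.prod_mul_distrib, ← Complex.exp_sum, mul_assoc (Finset.prod _ _), ← Complex.exp_add,
      h4]
    congr 2
    push_cast
    ring
  rw [h3, ← h2, mul_comm _ (Complex.exp _), ← mul_sub, norm_mul, Complex.norm_exp_ofReal_mul_I,
    one_mul]
  refine h1.trans ?_
  rw [Finset.mul_sum]
  refine Finset.sum_le_sum fun l _ => ?_
  refine (norm_bernoulli_sub_gaussian_le (hp l) (hp1 l) (θ * a l)).trans_eq ?_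
  rw [abs_mul]
  ring

theorem abs_sub_le_of_abs_hasDerivAt_le {f f' : ℝ → ℝ} {R C : ℝ}
    (hf : ∀ w, |w| ≤ R → HasDerivAt f (f' w) w) (hb : ∀ w, |w| ≤ R → |f' w| ≤ C) {w : ℝ}
    (hw : |w| ≤ R) : |f w - f 0| ≤ C * |w| := by
  have hR : 0 ≤ R := (abs_nonneg w).trans hw
  have h := (convex_Icc (-R) R).norm_image_sub_le_of_norm_hasDerivWithin_le (f := f) (f' := f')
    (C := C) (x := 0) (y := w) (fun x hx => (hf x (abs_le.mpr hx)).hasDerivWithinAt)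
    (fun x hx => hb x (abs_le.mpr hx)) (abs_le.mp (by simpa using hR)) (abs_le.mp hw)
  simpa using h

theorem abs_sub_taylor_two_le {F F₁ F₂ F₃ : ℝ → ℝ} {R C : ℝ}
    (h₀ : ∀ w, |w| ≤ R → HasDerivAt F (F₁ w) w) (h₁ : ∀ w, |w| ≤ R → HasDerivAt F₁ (F₂ w) w)
    (h₂ : ∀ w, |w| ≤ R → HasDerivAt F₂ (F₃ w) w) (h₃ : ∀ w, |w| ≤ R → |F₃ w| ≤ C) {w : ℝ}
    (hw : |w| ≤ R) : |F w - F 0 - F₁ 0 * w - F₂ 0 * w ^ 2 / 2| ≤ C * |w| ^ 3 := by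
  have hC : 0 ≤ C := (abs_nonneg _).trans (h₃ w hw)
  have e2 : ∀ y, |y| ≤ |w| → |F₂ y - F₂ 0| ≤ C * |w| := fun y hy =>
    (abs_sub_le_of_abs_hasDerivAt_le h₂ h₃ (hy.trans hw)).trans (by gcongr)
  have d1 : ∀ y, |y| ≤ |w| → HasDerivAt (fun y => F₁ y - F₂ 0 * y) (F₂ y - F₂ 0) y := by
    intro y hy
    exact ((h₁ y (hy.trans hw)).sub ((hasDerivAt_id y).const_mul (F₂ 0))).congr_deriv (by simp)
  have e1 : ∀ y, |y| ≤ |w| → |F₁ y - F₂ 0 * y - F₁ 0| ≤ C * |w| * |w| := by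
    intro y hy
    have := abs_sub_le_of_abs_hasDerivAt_le d1 e2 hy
    simp only [mul_zero, sub_zero] at this
    exact this.trans (by gcongr)
  have d0 : ∀ y, |y| ≤ |w| →
      HasDerivAt (fun y => F y - F₁ 0 * y - F₂ 0 * y ^ 2 / 2) (F₁ y - F₂ 0 * y - F₁ 0) y := by
    intro y hy
    have := ((h₀ y (hy.trans hw)).sub ((hasDerivAt_id y).const_mul (F₁ 0))).sub
      (((hasDerivAt_pow 2 y).const_mul (F₂ 0)).div_const 2)
    refine this.congr_deriv ?_
    simp
    ring
  have := abs_sub_le_of_abs_hasDerivAt_le d0 e1 le_rfl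
  simp only [mul_zero, sub_zero, ne_eq, OfNat.ofNat_ne_zero, not_false_eq_true, zero_pow,
    zero_div] at this
  calc _ = |F w - F₁ 0 * w - F₂ 0 * w ^ 2 / 2 - F 0| := by ring_nf
    _ ≤ _ := this
    _ = _ := by ring

/-- Success probability of the tilted Bernoulli variable attached to a part of size `y / ρ`. -/
noncomputable def tiltProb (y : ℝ) : ℝ := 1 / (1 + Real.exp y)

theorem tiltProb_nonneg (y : ℝ) : 0 ≤ tiltProb y := by unfold tiltProb; positivity

theorem tiltProb_le_one (y : ℝ) : tiltProb y ≤ 1 := by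
  unfold tiltProb
  rw [div_le_one (by positivity)]
  linarith [Real.exp_pos y]

theorem tiltProb_le_exp_neg (y : ℝ) : tiltProb y ≤ Real.exp (-y) := by
  unfold tiltProb
  rw [Real.exp_neg, ← one_div]
  exact one_div_le_one_div_of_le (Real.exp_pos y) (by linarith)

theorem hasDerivAt_tiltProb (y : ℝ) :
    HasDerivAt tiltProb (-(tiltProb y * (1 - tiltProb y))) y := by
  have h := ((Real.hasDerivAt_exp y).const_add 1).inv (by positivity)
  unfold tiltProb
  simp_rw [one_div]
  refine h.congr_deriv ?_
  have := Real.exp_pos y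
  field_simp
  ring

theorem hasDerivAt_log_one_add_exp_neg (y : ℝ) :
    HasDerivAt (fun y => Real.log (1 + Real.exp (-y))) (-tiltProb y) y := by
  have h := ((hasDerivAt_neg y).exp.const_add 1).log (by positivity)
  refine h.congr_deriv ?_
  unfold tiltProb
  rw [Real.exp_neg]
  have := Real.exp_pos y
  field_simp
  ring

theorem abs_log_one_add_exp_sub_taylor_le {x w : ℝ} (hw : |w| ≤ x / 2) :
    |Real.log (1 + Real.exp (-(x - w))) - Real.log (1 + Real.exp (-x)) - tiltProb x * w -
      tiltProb x * (1 - tiltProb x) * w ^ 2 / 2| ≤ Real.exp (-(x / 2)) * |w| ^ 3 := by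
  have hsub : ∀ y : ℝ, HasDerivAt (fun y => x - y) (-1) y := fun y => by
    simpa using (hasDerivAt_id y).const_sub x
  have d : ∀ y : ℝ, HasDerivAt (fun y => tiltProb (x - y))
      (tiltProb (x - y) * (1 - tiltProb (x - y))) y := fun y => by
    exact ((hasDerivAt_tiltProb (x - y)).comp y (hsub y)).congr_deriv (by ring)
  have h := abs_sub_taylor_two_le (R := x / 2) (C := Real.exp (-(x / 2)))
    (F := fun w => Real.log (1 + Real.exp (-(x - w)))) (F₁ := fun w => tiltProb (x - w))
    (F₂ := fun w => tiltProb (x - w) * (1 - tiltProb (x - w)))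
    (F₃ := fun w => tiltProb (x - w) * (1 - tiltProb (x - w)) * (1 - 2 * tiltProb (x - w)))
    (fun y _ => ((hasDerivAt_log_one_add_exp_neg (x - y)).comp y (hsub y)).congr_deriv (by ring))
    (fun y _ => d y)
    (fun y _ => ((d y).mul ((d y).const_sub 1)).congr_deriv (by ring))
    (fun y hy => by
      have h1 := tiltProb_nonneg (x - y)
      have h2 := tiltProb_le_one (x - y)
      have h3 : tiltProb (x - y) ≤ Real.exp (-(x / 2)) :=
        (tiltProb_le_exp_neg _).trans (Real.exp_le_exp.mpr (by linarith [(abs_le.mp hy).2]))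
      rw [abs_mul, abs_of_nonneg (mul_nonneg h1 (by linarith))]
      calc _ ≤ (tiltProb (x - y) * 1) * 1 := by
            gcongr
            · linarith
            · exact abs_le.mpr ⟨by linarith, by linarith⟩
        _ ≤ _ := by simpa using h3) hw
  simpa using h

theorem abs_one_sub_rpow_neg_sub_taylor_le {α : ℝ} (hα : 0 < α) {x : ℝ} (hx : |x| ≤ 1 / 2) :
    |(1 - x) ^ (-α) - 1 - α * x - α * (α + 1) * x ^ 2 / 2| ≤
      α * (α + 1) * (α + 2) * 2 ^ (α + 3) * |x| ^ 3 := by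
  have hsub : ∀ y : ℝ, HasDerivAt (fun y => 1 - y) (-1) y := fun y => by
    simpa using (hasDerivAt_id y).const_sub 1
  have hpos : ∀ y : ℝ, |y| ≤ 1 / 2 → 1 / 2 ≤ 1 - y := fun y hy => by linarith [(abs_le.mp hy).2]
  have d : ∀ b y : ℝ, |y| ≤ 1 / 2 →
      HasDerivAt (fun y : ℝ => (1 - y) ^ (-b)) (b * (1 - y) ^ (-(b + 1))) y := fun b y hy => by
    refine ((hsub y).rpow_const (p := -b) (Or.inl (by linarith [hpos y hy]))).congr_deriv ?_
    rw [show -b - 1 = -(b + 1) by ring]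
    ring
  have h := abs_sub_taylor_two_le (R := 1 / 2) (C := α * (α + 1) * (α + 2) * 2 ^ (α + 3))
    (F := fun x => (1 - x) ^ (-α)) (F₁ := fun x => α * (1 - x) ^ (-(α + 1)))
    (F₂ := fun x => α * ((α + 1) * (1 - x) ^ (-(α + 1 + 1))))
    (F₃ := fun x => α * ((α + 1) * ((α + 1 + 1) * (1 - x) ^ (-(α + 1 + 1 + 1)))))
    (d α) (fun y hy => (d _ y hy).const_mul _)
    (fun y hy => ((d _ y hy).const_mul _).const_mul _) (fun y hy => by
      have h1 := hpos y hy
      have h2 : (1 - y) ^ (-(α + 1 + 1 + 1)) ≤ 2 ^ (α + 3) := by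
        rw [show (2 : ℝ) ^ (α + 3) = (1 / 2) ^ (-(α + 3)) by
          rw [one_div, Real.inv_rpow (by norm_num), Real.rpow_neg (by norm_num), inv_inv],
          show α + 1 + 1 + 1 = α + 3 by ring]
        exact Real.rpow_le_rpow_of_nonpos (by norm_num) h1 (by linarith)
      have h3 : 0 ≤ (1 - y) ^ (-(α + 1 + 1 + 1)) := Real.rpow_nonneg (by linarith) _
      rw [abs_of_nonneg (by positivity)]
      calc _ ≤ α * ((α + 1) * ((α + 1 + 1) * 2 ^ (α + 3))) := by gcongr
        _ = _ := by ring) hx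
  simp only [sub_zero, Real.one_rpow, mul_one] at h
  exact h

/-- Truncation of `logProd κ s` to the first `n` factors. -/
noncomputable def logProdTrunc (κ : ℝ) (n : ℕ) (s : ℝ) : ℝ :=
  ∑ l ∈ Finset.range n, Real.log (1 + Real.exp (-(s * psPart κ (l + 1))))

/-- Mean of the tilted sum of parts. -/
noncomputable def tiltMean (κ : ℝ) (n : ℕ) (s : ℝ) : ℝ :=
  ∑ l ∈ Finset.range n, (psPart κ (l + 1) : ℝ) * tiltProb (s * psPart κ (l + 1))

/-- Variance of the tilted sum of parts. -/
noncomputable def tiltVar (κ : ℝ) (n : ℕ) (s : ℝ) : ℝ :=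
  ∑ l ∈ Finset.range n, (psPart κ (l + 1) : ℝ) ^ 2 *
    (tiltProb (s * psPart κ (l + 1)) * (1 - tiltProb (s * psPart κ (l + 1))))

/-- An upper bound for the third moments of the tilted parts. -/
noncomputable def tiltThird (κ : ℝ) (n : ℕ) (s : ℝ) : ℝ :=
  ∑ l ∈ Finset.range n, (psPart κ (l + 1) : ℝ) ^ 3 * Real.exp (-(s * psPart κ (l + 1) / 2))

theorem abs_logProdTrunc_sub_taylor_le {κ s h : ℝ} (hh : |h| ≤ s / 2) (n : ℕ) :
    |logProdTrunc κ n (s - h) - logProdTrunc κ n s - h * tiltMean κ n s -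
      h ^ 2 * tiltVar κ n s / 2| ≤ |h| ^ 3 * tiltThird κ n s := by
  unfold logProdTrunc tiltMean tiltVar tiltThird
  rw [Finset.mul_sum, Finset.mul_sum, Finset.mul_sum, Finset.sum_div, ← Finset.sum_sub_distrib,
    ← Finset.sum_sub_distrib, ← Finset.sum_sub_distrib]
  refine (Finset.abs_sum_le_sum_abs _ _).trans (Finset.sum_le_sum fun l _ => ?_)
  have ha : (0 : ℝ) ≤ psPart κ (l + 1) := by positivity
  have h1 := abs_log_one_add_exp_sub_taylor_le (x := s * psPart κ (l + 1))
    (w := h * psPart κ (l + 1)) (by rw [abs_mul, abs_of_nonneg ha]; nlinarith)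
  rw [← sub_mul, abs_mul h, abs_of_nonneg ha] at h1
  calc _ = _ := by ring_nf
    _ ≤ _ := h1
    _ = _ := by ring

theorem tiltThird_nonneg (κ : ℝ) (n : ℕ) (s : ℝ) : 0 ≤ tiltThird κ n s :=
  Finset.sum_nonneg fun _ _ => by positivity

theorem tiltThird_le {κ s : ℝ} (hκ : 1 ≤ κ) (hs : 0 < s) (n : ℕ) :
    tiltThird κ n s ≤ 768 * s⁻¹ ^ 3 * logProd κ (s / 4) := by
  have h1 := (logProd_sub_sum_mem_Icc hκ (by positivity : 0 < s / 4) n).1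
  calc tiltThird κ n s ≤ ∑ l ∈ Finset.range n, 768 * s⁻¹ ^ 3 *
        Real.log (1 + Real.exp (-(s / 4 * psPart κ (l + 1)))) := by
        refine Finset.sum_le_sum fun l _ => ?_
        set a : ℝ := (psPart κ (l + 1) : ℝ)
        have ha : 0 ≤ a := by positivity
        have h2 := Real.pow_div_factorial_le_exp (s / 4 * a) (by positivity) 3
        have h3 := exp_neg_le_two_mul_log (y := s / 4 * a) (by positivity)
        have h4 : Real.exp (-(s * a / 2)) = Real.exp (-(s / 4 * a)) * Real.exp (-(s / 4 * a)) := by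
          rw [← Real.exp_add]; ring_nf
        have h5 : a ^ 3 = 384 * s⁻¹ ^ 3 * ((s / 4 * a) ^ 3 / (Nat.factorial 3 : ℝ)) := by
          simp [Nat.factorial]
          field_simp
          ring
        calc a ^ 3 * Real.exp (-(s * a / 2))
            ≤ 384 * s⁻¹ ^ 3 * Real.exp (s / 4 * a) * Real.exp (-(s * a / 2)) := by
              rw [h5]; gcongr
          _ = 384 * s⁻¹ ^ 3 * Real.exp (-(s / 4 * a)) := by
              rw [h4, mul_assoc (384 * s⁻¹ ^ 3), ← mul_assoc (Real.exp (s / 4 * a)),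
                ← Real.exp_add, add_neg_cancel, Real.exp_zero, one_mul]
          _ ≤ 384 * s⁻¹ ^ 3 * (2 * Real.log (1 + Real.exp (-(s / 4 * a)))) := by gcongr
          _ = _ := by ring
    _ = 768 * s⁻¹ ^ 3 * ∑ l ∈ Finset.range n,
        Real.log (1 + Real.exp (-(s / 4 * psPart κ (l + 1)))) := by rw [Finset.mul_sum]
    _ ≤ _ := by gcongr; linarith

theorem tendsto_inv_mul_exp_neg_rpow {α c : ℝ} (hα : 0 < α) (hc : 0 < c) :
    Tendsto (fun y : ℝ => y⁻¹ * Real.exp (-(c * y ^ (-α)))) (𝓝[>] 0) (𝓝 0) := by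
  have h1 : Tendsto (fun y : ℝ => y ^ (-α)) (𝓝[>] 0) atTop :=
    tendsto_rpow_neg_nhdsGT_zero (by linarith)
  refine ((tendsto_rpow_mul_exp_neg_mul_atTop_nhds_zero (1 / α) c hc).comp h1).congr' ?_
  filter_upwards [self_mem_nhdsWithin] with y hy
  have hy : 0 < y := hy
  simp only [Function.comp]
  rw [← Real.rpow_mul hy.le, neg_mul, mul_one_div_cancel hα.ne', Real.rpow_neg_one, neg_mul]

theorem tendsto_rpow_nhdsGT_zero {e : ℝ} (he : 0 < e) :
    Tendsto (fun s : ℝ => s ^ e) (𝓝[>] 0) (𝓝 0) := by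
  have := (Real.continuous_rpow_const he.le).tendsto 0
  rw [Real.zero_rpow he.ne'] at this
  exact this.mono_left nhdsWithin_le_nhds

section Saddle

variable {κ α A c₀ : ℝ} {ρ : ℕ → ℝ}

theorem tendsto_logProdTrunc_sub (hκ : 1 ≤ κ) (hα : 0 < α) (hA : 0 < A)
    (hL : Tendsto (fun s => logProd κ s - A * s ^ (-α) + c₀) (𝓝[>] 0) (𝓝 0))
    (hρ : Tendsto ρ atTop (𝓝[>] 0)) (hn : ∀ᶠ n : ℕ in atTop, (n : ℝ) = α * A * ρ n ^ (-(1 + α)))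
    {s : ℕ → ℝ} (hs : Tendsto s atTop (𝓝[>] 0)) (hsρ : ∀ᶠ n in atTop, ρ n / 2 ≤ s n) :
    Tendsto (fun n => logProdTrunc κ n (s n) - A * s n ^ (-α) + c₀) atTop (𝓝 0) := by
  have h1 := hL.comp hs
  have h2 : Tendsto (fun n => logProd κ (s n) - logProdTrunc κ n (s n)) atTop (𝓝 0) := by
    have h3 := ((tendsto_inv_mul_exp_neg_rpow hα (by positivity : 0 < α * A / 2)).comp
      hρ).const_mul 2
    rw [mul_zero] at h3
    refine squeeze_zero' ?_ ?_ h3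
    · filter_upwards [hs.eventually self_mem_nhdsWithin] with n hsn
      exact (logProd_sub_sum_mem_Icc hκ hsn n).1
    · filter_upwards [hs.eventually self_mem_nhdsWithin, hρ.eventually self_mem_nhdsWithin, hn,
        hsρ] with n hsn hρn hnn hsρn
      have hρn : 0 < ρ n := hρn
      have hsn : 0 < s n := hsn
      refine (logProd_sub_sum_mem_Icc hκ hsn n).2.trans ?_
      have h4 : ρ n * (n : ℝ) = α * A * ρ n ^ (-α) := by
        rw [hnn, neg_add, Real.rpow_add hρn, Real.rpow_neg_one]
        field_simp
      simp only [Function.comp]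
      have h5 : Real.exp (-(s n * n)) ≤ Real.exp (-(α * A / 2 * ρ n ^ (-α))) := by
        refine Real.exp_le_exp.mpr ?_
        nlinarith [(Nat.cast_nonneg n : (0 : ℝ) ≤ n)]
      calc _ ≤ Real.exp (-(α * A / 2 * ρ n ^ (-α))) / (ρ n / 2) := by gcongr
        _ = _ := by field_simp
  have h3 := h1.sub h2
  rw [sub_zero] at h3
  refine h3.congr fun n => ?_
  simp only [Function.comp]
  ring

theorem tendsto_logProdTrunc_increment (hκ : 1 ≤ κ) (hα : 0 < α) (hA : 0 < A)
    (hL : Tendsto (fun s => logProd κ s - A * s ^ (-α) + c₀) (𝓝[>] 0) (𝓝 0))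
    (hρ : Tendsto ρ atTop (𝓝[>] 0)) (hn : ∀ᶠ n : ℕ in atTop, (n : ℝ) = α * A * ρ n ^ (-(1 + α)))
    (η : ℝ) :
    Tendsto (fun n => logProdTrunc κ n (ρ n - η * ρ n ^ (1 + α / 2)) - logProdTrunc κ n (ρ n) -
      η * ρ n ^ (1 + α / 2) * n) atTop (𝓝 (A * (α * (α + 1) * η ^ 2 / 2))) := by
  have hpow : ∀ e : ℝ, 0 < e → Tendsto (fun n => ρ n ^ e) atTop (𝓝 0) := fun e he =>
    (tendsto_rpow_nhdsGT_zero he).comp hρ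
  have hρ0 : Tendsto ρ atTop (𝓝 0) := hρ.mono_right nhdsWithin_le_nhds
  have hx : Tendsto (fun n => η * ρ n ^ (α / 2)) atTop (𝓝 0) := by
    simpa using (hpow (α / 2) (by positivity)).const_mul η
  have hxsmall : ∀ᶠ n in atTop, |η * ρ n ^ (α / 2)| ≤ 1 / 2 := by
    have := hx.abs
    rw [abs_zero] at this
    exact (this.eventually_lt_const (by norm_num : (0 : ℝ) < 1 / 2)).mono fun _ h => h.le
  have hρpos : ∀ᶠ n in atTop, 0 < ρ n := hρ.eventually self_mem_nhdsWithin
  have hfac : ∀ᶠ n in atTop, ρ n - η * ρ n ^ (1 + α / 2) = ρ n * (1 - η * ρ n ^ (α / 2)) := by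
    filter_upwards [hρpos] with n h
    rw [Real.rpow_add h, Real.rpow_one]
    ring
  have hsge : ∀ᶠ n in atTop, ρ n / 2 ≤ ρ n - η * ρ n ^ (1 + α / 2) := by
    filter_upwards [hρpos, hxsmall, hfac] with n h1 h2 h3
    rw [h3]
    nlinarith [(abs_le.mp h2).2]
  have hs : Tendsto (fun n => ρ n - η * ρ n ^ (1 + α / 2)) atTop (𝓝[>] 0) := by
    refine tendsto_nhdsWithin_iff.mpr ⟨?_, ?_⟩
    · simpa using hρ0.sub ((hpow (1 + α / 2) (by positivity)).const_mul η)
    · filter_upwards [hρpos, hsge] with n h1 h2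
      exact lt_of_lt_of_le (half_pos h1) h2
  have h1 := tendsto_logProdTrunc_sub hκ hα hA hL hρ hn hs hsge
  have h2 := tendsto_logProdTrunc_sub hκ hα hA hL hρ hn hρ
    (hρpos.mono fun n h => by linarith)
  have h3 : Tendsto (fun n => A * ρ n ^ (-α) * ((1 - η * ρ n ^ (α / 2)) ^ (-α) - 1 -
      α * (η * ρ n ^ (α / 2)) - α * (α + 1) * (η * ρ n ^ (α / 2)) ^ 2 / 2)) atTop (𝓝 0) := by
    have hb := ((hpow (α / 2) (by positivity)).const_mul
      (A * (α * (α + 1) * (α + 2) * 2 ^ (α + 3) * |η| ^ 3)))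
    rw [mul_zero] at hb
    refine squeeze_zero_norm' ?_ hb
    filter_upwards [hρpos, hxsmall] with n h4 h5
    have h6 := abs_one_sub_rpow_neg_sub_taylor_le hα h5
    rw [Real.norm_eq_abs, abs_mul, abs_of_pos (by positivity)]
    calc _ ≤ A * ρ n ^ (-α) * (α * (α + 1) * (α + 2) * 2 ^ (α + 3) * |η * ρ n ^ (α / 2)| ^ 3) := by
          gcongr
      _ = A * (α * (α + 1) * (α + 2) * 2 ^ (α + 3) * |η| ^ 3) *
          (ρ n ^ (-α) * (ρ n ^ (α / 2)) ^ 3) := by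
          rw [abs_mul, abs_of_pos (Real.rpow_pos_of_pos h4 (α / 2))]; ring
      _ = _ := by
          rw [← Real.rpow_natCast (ρ n ^ (α / 2)) 3, ← Real.rpow_mul h4.le, ← Real.rpow_add h4]
          congr 2
          push_cast
          ring
  have h4 := ((h1.sub h2).add h3).add
    (tendsto_const_nhds (x := A * (α * (α + 1) * η ^ 2 / 2)))
  rw [sub_zero, zero_add, zero_add] at h4
  refine h4.congr' ?_
  filter_upwards [hρpos, hxsmall, hfac, hn] with n hp hxs hf hnn
  have e1 : (ρ n * (1 - η * ρ n ^ (α / 2))) ^ (-α) =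
      ρ n ^ (-α) * (1 - η * ρ n ^ (α / 2)) ^ (-α) :=
    Real.mul_rpow hp.le (by linarith [(abs_le.mp hxs).2])
  have e2 : ρ n ^ (-α) * (ρ n ^ (α / 2)) ^ 2 = 1 := by
    rw [← Real.rpow_natCast (ρ n ^ (α / 2)) 2, ← Real.rpow_mul hp.le, ← Real.rpow_add hp]
    push_cast
    rw [show -α + α / 2 * 2 = 0 by ring, Real.rpow_zero]
  have e3 : ρ n ^ (1 + α / 2) * (n : ℝ) = α * A * (ρ n ^ (-α) * ρ n ^ (α / 2)) := by
    rw [hnn, ← Real.rpow_add hp, mul_left_comm, ← Real.rpow_add hp]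
    ring_nf
  have e4 : (ρ n - η * ρ n ^ (1 + α / 2)) ^ (-α) =
      ρ n ^ (-α) * (1 - η * ρ n ^ (α / 2)) ^ (-α) := by rw [hf, e1]
  rw [e4, mul_assoc η, e3]
  linear_combination (-(A * (α * (α + 1) * η ^ 2 / 2))) * e2

theorem tendsto_tiltThird (hκ : 1 ≤ κ) (hα : 0 < α)
    (hL : Tendsto (fun s => logProd κ s - A * s ^ (-α) + c₀) (𝓝[>] 0) (𝓝 0))
    (hρ : Tendsto ρ atTop (𝓝[>] 0)) :
    Tendsto (fun n => (ρ n ^ (1 + α / 2)) ^ 3 * tiltThird κ n (ρ n)) atTop (𝓝 0) := by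
  have hpow : ∀ e : ℝ, 0 < e → Tendsto (fun n => ρ n ^ e) atTop (𝓝 0) := fun e he =>
    (tendsto_rpow_nhdsGT_zero he).comp hρ
  have hρpos : ∀ᶠ n in atTop, 0 < ρ n := hρ.eventually self_mem_nhdsWithin
  have hρ4 : Tendsto (fun n => ρ n / 4) atTop (𝓝[>] 0) := by
    refine tendsto_nhdsWithin_iff.mpr ⟨?_, hρpos.mono fun n h => ?_⟩
    · simpa using (hρ.mono_right nhdsWithin_le_nhds).div_const 4
    · exact div_pos h (by norm_num)
  have h1 := ((((hpow (3 * α / 2) (by positivity)).mul (hL.comp hρ4)).add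
    ((hpow (α / 2) (by positivity)).const_mul (A * (1 / 4) ^ (-α)))).sub
    ((hpow (3 * α / 2) (by positivity)).const_mul c₀)).const_mul 768
  simp only [mul_zero, add_zero, sub_zero] at h1
  refine squeeze_zero' (hρpos.mono fun n h => mul_nonneg (by positivity)
    (tiltThird_nonneg _ _ _)) ?_ h1
  filter_upwards [hρpos] with n hp
  have e1 : (ρ n ^ (1 + α / 2)) ^ 3 = ρ n ^ 3 * ρ n ^ (3 * α / 2) := by
    rw [Real.rpow_add hp, Real.rpow_one, mul_pow, ← Real.rpow_natCast (ρ n ^ (α / 2)) 3,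
      ← Real.rpow_mul hp.le]
    push_cast
    ring_nf
  have e2 : (ρ n / 4) ^ (-α) = ρ n ^ (-α) * (1 / 4) ^ (-α) := by
    rw [div_eq_mul_one_div, Real.mul_rpow hp.le (by norm_num)]
  have e3 : ρ n ^ (3 * α / 2) * ρ n ^ (-α) = ρ n ^ (α / 2) := by
    rw [← Real.rpow_add hp]; ring_nf
  calc _ ≤ (ρ n ^ (1 + α / 2)) ^ 3 * (768 * (ρ n)⁻¹ ^ 3 * logProd κ (ρ n / 4)) := by
        gcongr; exact tiltThird_le hκ hp n
    _ = 768 * (ρ n ^ (3 * α / 2) * logProd κ (ρ n / 4)) := by rw [e1]; field_simp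
    _ = _ := by
        simp only [Function.comp]
        rw [e2, ← e3]
        ring

theorem tendsto_tilt_moments (hκ : 1 ≤ κ) (hα : 0 < α) (hA : 0 < A)
    (hL : Tendsto (fun s => logProd κ s - A * s ^ (-α) + c₀) (𝓝[>] 0) (𝓝 0))
    (hρ : Tendsto ρ atTop (𝓝[>] 0)) (hn : ∀ᶠ n : ℕ in atTop, (n : ℝ) = α * A * ρ n ^ (-(1 + α))) :
    Tendsto (fun n => ρ n ^ (1 + α / 2) * (tiltMean κ n (ρ n) - n)) atTop (𝓝 0) ∧
    Tendsto (fun n => (ρ n ^ (1 + α / 2)) ^ 2 * tiltVar κ n (ρ n)) atTop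
      (𝓝 (A * (α * (α + 1)))) := by
  have hρpos : ∀ᶠ n in atTop, 0 < ρ n := hρ.eventually self_mem_nhdsWithin
  have hT := tendsto_tiltThird hκ hα hL hρ
  have hpow : Tendsto (fun n => ρ n ^ (α / 2)) atTop (𝓝 0) :=
    (tendsto_rpow_nhdsGT_zero (half_pos hα)).comp hρ
  have hsmall : ∀ᶠ n in atTop, ρ n ^ (1 + α / 2) ≤ ρ n / 2 := by
    filter_upwards [hρpos, hpow.eventually_lt_const (by norm_num : (0 : ℝ) < 1 / 2)] with n h1 h2
    rw [Real.rpow_add h1, Real.rpow_one]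
    nlinarith
  have key : ∀ η : ℝ, |η| = 1 → Tendsto (fun n => η * (ρ n ^ (1 + α / 2) *
      (tiltMean κ n (ρ n) - n)) + (ρ n ^ (1 + α / 2)) ^ 2 * tiltVar κ n (ρ n) / 2) atTop
      (𝓝 (A * (α * (α + 1)) / 2)) := by
    intro η hη
    have hη2 : η ^ 2 = 1 := by rw [← sq_abs, hη, one_pow]
    have h1 := tendsto_logProdTrunc_increment hκ hα hA hL hρ hn η
    have h2 : Tendsto (fun n => logProdTrunc κ n (ρ n - η * ρ n ^ (1 + α / 2)) -
        logProdTrunc κ n (ρ n) - η * ρ n ^ (1 + α / 2) * tiltMean κ n (ρ n) -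
        (η * ρ n ^ (1 + α / 2)) ^ 2 * tiltVar κ n (ρ n) / 2) atTop (𝓝 0) := by
      refine squeeze_zero_norm' ?_ hT
      filter_upwards [hρpos, hsmall] with n hp hs
      have h3 : |η * ρ n ^ (1 + α / 2)| = ρ n ^ (1 + α / 2) := by
        rw [abs_mul, hη, one_mul, abs_of_pos (by positivity)]
      have h4 := abs_logProdTrunc_sub_taylor_le (κ := κ) (s := ρ n)
        (h := η * ρ n ^ (1 + α / 2)) (by rw [h3]; exact hs) n
      rw [h3] at h4
      exact h4
    have h3 := h1.sub h2
    rw [hη2, sub_zero, mul_one] at h3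
    rw [mul_div_assoc]
    refine h3.congr fun n => ?_
    rw [mul_pow, hη2]
    ring
  have k1 := key 1 (by simp)
  have k2 := key (-1) (by simp)
  constructor
  · have := (k1.sub k2).div_const 2
    rw [sub_self, zero_div] at this
    refine this.congr fun n => ?_
    ring
  · have := k1.add k2
    rw [add_halves] at this
    refine this.congr fun n => ?_
    ring

end Saddle

theorem one_div_eight_le_tiltProb_mul {y : ℝ} (hy : 0 ≤ y) (hy1 : y ≤ 1) :
    1 / 8 ≤ tiltProb y * (1 - tiltProb y) := by
  have h1 : 1 ≤ Real.exp y := Real.one_le_exp hy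
  have h2 : Real.exp y ≤ 3 :=
    (Real.exp_le_exp.mpr hy1).trans (by linarith [Real.exp_one_lt_d9])
  have h3 : tiltProb y * (1 - tiltProb y) = Real.exp y / (1 + Real.exp y) ^ 2 := by
    unfold tiltProb
    field_simp
    ring
  rw [h3, div_le_div_iff₀ (by norm_num) (by positivity)]
  nlinarith

theorem eight_mul_sq_sub_round_le_one_sub_cos (x : ℝ) :
    8 * (x - round x) ^ 2 ≤ 1 - Real.cos (2 * π * x) := by
  have h1 : Real.cos (2 * π * x) = Real.cos (2 * π * (x - round x)) := by
    rw [mul_sub, mul_comm (2 * π) (round x : ℝ), Real.cos_sub_int_mul_two_pi]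
  have h2 : |2 * π * (x - round x)| ≤ π := by
    rw [abs_mul, abs_of_pos (by positivity)]
    nlinarith [abs_sub_round x, Real.pi_pos]
  have h3 := Real.cos_le_one_sub_mul_cos_sq h2
  have h4 : 2 / π ^ 2 * (2 * π * (x - round x)) ^ 2 = 8 * (x - round x) ^ 2 := by
    field_simp
    ring
  rw [h1]
  linarith

/-- Characteristic function, centred at `n`, of the tilted sum of the first `n` parts. -/
noncomputable def tiltChar (κ : ℝ) (n : ℕ) (s θ : ℝ) : ℂ :=
  (∏ l ∈ Finset.range n, (1 - tiltProb (s * psPart κ (l + 1)) +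
    tiltProb (s * psPart κ (l + 1)) * Complex.exp ((θ * psPart κ (l + 1) : ℝ) * Complex.I))) *
    Complex.exp (-(n * θ * Complex.I))

theorem continuous_tiltChar (κ : ℝ) (n : ℕ) (s : ℝ) : Continuous (tiltChar κ n s) := by
  unfold tiltChar
  fun_prop

theorem prod_one_add_exp_eq (κ : ℝ) (n : ℕ) (s θ : ℝ) :
    (∏ l ∈ Finset.range n, (1 + Complex.exp ((-s + θ * Complex.I) * psPart κ (l + 1)))) *
      Complex.exp (-(n * θ * Complex.I)) =
    Real.exp (logProdTrunc κ n s) * tiltChar κ n s θ := by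
  unfold tiltChar logProdTrunc
  rw [← mul_assoc, Real.exp_sum, Complex.ofReal_prod, ← Finset.prod_mul_distrib]
  congr 1
  refine Finset.prod_congr rfl fun l _ => ?_
  set a : ℝ := (psPart κ (l + 1) : ℝ) with ha
  have h1 : (psPart κ (l + 1) : ℂ) = (a : ℂ) := by simp [ha]
  rw [Real.exp_log (by positivity)]
  have h2 : Complex.exp ((-s + θ * Complex.I) * psPart κ (l + 1)) =
      (Real.exp (-(s * a)) : ℝ) * Complex.exp ((θ * a : ℝ) * Complex.I) := by
    rw [h1, Complex.ofReal_exp, ← Complex.exp_add]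
    push_cast
    ring_nf
  have h3 : (1 + Real.exp (-(s * a))) * tiltProb (s * a) = Real.exp (-(s * a)) := by
    unfold tiltProb
    rw [Real.exp_neg]
    have := Real.exp_pos (s * a)
    field_simp
    ring
  have h4 : ((1 + Real.exp (-(s * a)) : ℝ) : ℂ) * (tiltProb (s * a) : ℂ) =
      (Real.exp (-(s * a)) : ℝ) := by rw [← Complex.ofReal_mul, h3]
  have h5 : ((1 + Real.exp (-(s * a)) : ℝ) : ℂ) = 1 + (Real.exp (-(s * a)) : ℝ) := by
    push_cast; rfl
  rw [h2]
  linear_combination (1 - Complex.exp ((θ * a : ℝ) * Complex.I)) * h4 - h5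

theorem qk_eq_integral_tiltChar {κ : ℝ} (hκ : 1 ≤ κ) (n : ℕ) (s : ℝ) :
    (qk κ n : ℂ) = (Real.exp (s * n + logProdTrunc κ n s) / (2 * π) : ℝ) *
      ∫ θ in (-π)..π, tiltChar κ n s θ := by
  have h1 := integral_prod_one_add_exp (fun l => psPart κ (l + 1)) s n n
  rw [← qk_eq_card hκ] at h1
  simp only [prod_one_add_exp_eq, intervalIntegral.integral_const_mul] at h1
  have h2 : (Real.exp (-(s * n)) : ℂ) * Real.exp (s * n) = 1 := by
    rw [← Complex.ofReal_mul, ← Real.exp_add]; simp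
  have h3 : (π : ℂ) ≠ 0 := by exact_mod_cast Real.pi_ne_zero
  rw [Real.exp_add]
  push_cast at h1 h2 ⊢
  field_simp
  linear_combination (-Complex.exp (s * n)) * h1 - 2 * π * (qk κ n : ℂ) * h2

theorem norm_tiltChar_le {κ s : ℝ} (hs : 0 ≤ s) {n N : ℕ} (hN : N ≤ n)
    (hNs : ∀ l < N, s * psPart κ (l + 1) ≤ 1) (x : ℝ) :
    ‖tiltChar κ n s (2 * π * x)‖ ≤ Real.exp (-∑ l ∈ Finset.range N,
      (x * psPart κ (l + 1) - round (x * psPart κ (l + 1) : ℝ)) ^ 2) := by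
  have hexp : ‖Complex.exp (-(n * (2 * π * x : ℝ) * Complex.I))‖ = 1 := by
    rw [show (-(n * (2 * π * x : ℝ) * Complex.I) : ℂ) = ((-(n * (2 * π * x)) : ℝ) : ℂ) * Complex.I
      by push_cast; ring]
    exact Complex.norm_exp_ofReal_mul_I _
  have hfac : ∀ l, ‖(1 - tiltProb (s * psPart κ (l + 1)) + tiltProb (s * psPart κ (l + 1)) *
      Complex.exp ((2 * π * x * psPart κ (l + 1) : ℝ) * Complex.I) : ℂ)‖ ≤
      Real.exp (-(tiltProb (s * psPart κ (l + 1)) * (1 - tiltProb (s * psPart κ (l + 1))) *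
        (1 - Real.cos (2 * π * x * psPart κ (l + 1))))) := fun l =>
    norm_one_sub_add_mul_exp_le _ _
  unfold tiltChar
  rw [norm_mul, hexp, mul_one, norm_prod]
  refine (Finset.prod_le_prod (fun _ _ => norm_nonneg _) fun l _ => hfac l).trans ?_
  rw [← Real.exp_sum]
  refine Real.exp_le_exp.mpr ?_
  rw [Finset.sum_neg_distrib]
  refine neg_le_neg ?_
  have hnn : ∀ l, 0 ≤ tiltProb (s * psPart κ (l + 1)) * (1 - tiltProb (s * psPart κ (l + 1))) *
        (1 - Real.cos (2 * π * x * psPart κ (l + 1))) := fun l =>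
    mul_nonneg (mul_nonneg (tiltProb_nonneg _) (sub_nonneg.mpr (tiltProb_le_one _)))
      (sub_nonneg.mpr (Real.cos_le_one _))
  refine le_trans (Finset.sum_le_sum fun l hl => ?_)
    (Finset.sum_le_sum_of_subset_of_nonneg (Finset.range_mono hN) fun l _ _ => hnn l)
  have h1 := one_div_eight_le_tiltProb_mul (y := s * psPart κ (l + 1)) (by positivity)
    (hNs l (Finset.mem_range.mp hl))
  have h2 := eight_mul_sq_sub_round_le_one_sub_cos (x * psPart κ (l + 1))
  rw [← mul_assoc (2 * π)] at h2
  nlinarith [sq_nonneg (x * psPart κ (l + 1) - round (x * psPart κ (l + 1) : ℝ))]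

theorem norm_tiltChar_sub_le {κ s : ℝ} (hs : 0 ≤ s) (n : ℕ) (θ : ℝ) :
    ‖tiltChar κ n s θ - Complex.exp (((tiltMean κ n s - n) * θ : ℝ) * Complex.I) *
      Real.exp (-(tiltVar κ n s * θ ^ 2 / 2))‖ ≤ 5 * |θ| ^ 3 * tiltThird κ n s := by
  have h1 := norm_prod_bernoulli_sub_gaussian_le
    (p := fun l => tiltProb (s * psPart κ (l + 1))) (fun _ => tiltProb_nonneg _)
    (fun _ => tiltProb_le_one _) (fun l => (psPart κ (l + 1) : ℝ)) θ n n
  refine le_trans (le_of_eq ?_) (h1.trans ?_)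
  · simp [tiltChar, tiltMean, tiltVar]
  · unfold tiltThird
    gcongr with l _
    · exact tiltProb_nonneg _
    · rw [Nat.abs_cast]
    · refine (tiltProb_le_exp_neg _).trans (Real.exp_le_exp.mpr ?_)
      have : 0 ≤ s * psPart κ (l + 1) := by positivity
      linarith

theorem eventually_one_add_mul_rpow_mul_exp_le (C e : ℝ) {b δ : ℝ} (hb : 0 < b) (hδ : 0 < δ) :
    ∀ᶠ M : ℝ in atTop, (1 + C * M ^ e) * Real.exp (-(b * M ^ δ)) ≤ 1 := by
  have h1 := tendsto_rpow_atTop hδ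
  have h2 := ((tendsto_rpow_mul_exp_neg_mul_atTop_nhds_zero 0 b hb).comp h1).add
    (((tendsto_rpow_mul_exp_neg_mul_atTop_nhds_zero (e / δ) b hb).comp h1).const_mul C)
  rw [mul_zero, add_zero] at h2
  filter_upwards [h2.eventually_le_const (by norm_num : (0 : ℝ) < 1), eventually_ge_atTop 0]
    with M h3 hM
  simp only [Function.comp] at h3
  rw [Real.rpow_zero, ← Real.rpow_mul hM, mul_div_cancel₀ _ hδ.ne', neg_mul] at h3
  linarith

section Saddle

variable {κ α A c₀ : ℝ} {ρ : ℕ → ℝ}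

theorem exists_eventually_norm_tiltChar_le (hκ : 1 < κ) (hα : α = 1 / κ) (hA : 0 < A)
    (hρ : Tendsto ρ atTop (𝓝[>] 0)) (hn : ∀ᶠ n : ℕ in atTop, (n : ℝ) = α * A * ρ n ^ (-(1 + α))) :
    ∃ c > 0, ∀ᶠ n in atTop, ∀ u : ℝ, |u| ≤ π / ρ n ^ (1 + α / 2) →
      ‖tiltChar κ n (ρ n) (ρ n ^ (1 + α / 2) * u)‖ ≤
        Real.exp (-c * u ^ 2) + (1 + u ^ 2)⁻¹ := by
  obtain ⟨c, hc, δ, hδ, hmin⟩ := exists_min_le_sum_sq_sub_round hκ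
  have hα0 : 0 < α := by rw [hα]; positivity
  have hακ : α * κ = 1 := by rw [hα]; field_simp
  have hρpos : ∀ᶠ n in atTop, 0 < ρ n := hρ.eventually self_mem_nhdsWithin
  have hM : Tendsto (fun n => ρ n ^ (-α)) atTop atTop :=
    (tendsto_rpow_neg_nhdsGT_zero (by linarith)).comp hρ
  have hN : Tendsto (fun n => ⌊ρ n ^ (-α)⌋₊) atTop atTop := tendsto_nat_floor_atTop.comp hM
  refine ⟨c * (1 / 2) ^ (2 * κ + 1) * (1 / (2 * π)) ^ 2, by positivity, ?_⟩
  filter_upwards [hN.eventually hmin, hρpos, hn, hM.eventually_ge_atTop 2,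
    (hρ.mono_right nhdsWithin_le_nhds).eventually_le_const (by positivity : 0 < α * A),
    hM.eventually (eventually_one_add_mul_rpow_mul_exp_le (π ^ 2) (2 * κ + 1)
      (by positivity : 0 < (1 / 2 : ℝ) ^ δ) hδ)] with n hmin hp hnn hM2 hle hexp u hu
  set τ := ρ n ^ (1 + α / 2) with hτ
  set M := ρ n ^ (-α) with hMdef
  set N := ⌊M⌋₊ with hNdef
  have hτ0 : 0 < τ := by positivity
  have hNM : (N : ℝ) ≤ M := Nat.floor_le (by positivity)
  have hMN : 1 / 2 * M ≤ N := by linarith [Nat.lt_floor_add_one M]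
  have hNn : N ≤ n := by
    have : (N : ℝ) ≤ n := by
      refine hNM.trans ?_
      rw [hnn, neg_add, Real.rpow_add hp, Real.rpow_neg_one, ← hMdef]
      have : 1 ≤ α * A * (ρ n)⁻¹ := by
        rw [← div_eq_mul_inv, one_le_div hp]; exact hle
      nlinarith
    exact_mod_cast this
  have hNs : ∀ l < N, ρ n * psPart κ (l + 1) ≤ 1 := by
    intro l hl
    have h1 : (psPart κ (l + 1) : ℝ) ≤ M ^ κ := by
      refine (psPart_le_rpow κ (l + 1)).trans (Real.rpow_le_rpow (by positivity) ?_ (by linarith))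
      refine le_trans ?_ hNM
      exact_mod_cast hl
    have h2 : M ^ κ = (ρ n)⁻¹ := by
      rw [hMdef, ← Real.rpow_mul hp.le, neg_mul, hακ, Real.rpow_neg_one]
    rw [h2] at h1
    calc ρ n * psPart κ (l + 1) ≤ ρ n * (ρ n)⁻¹ := by gcongr
      _ = 1 := mul_inv_cancel₀ hp.ne'
  have hMτ : M ^ (2 * κ + 1) * τ ^ 2 = 1 := by
    rw [hMdef, hτ, ← Real.rpow_mul hp.le, ← Real.rpow_natCast (ρ n ^ (1 + α / 2)),
      ← Real.rpow_mul hp.le, ← Real.rpow_add hp]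
    push_cast
    rw [show -α * (2 * κ + 1) + (1 + α / 2) * 2 = 0 by linear_combination (-2) * hακ,
      Real.rpow_zero]
  have hx : |τ * u / (2 * π)| ≤ 1 / 2 := by
    rw [abs_div, abs_mul, abs_of_pos hτ0, abs_of_pos (by positivity : 0 < 2 * π),
      div_le_iff₀ (by positivity)]
    calc τ * |u| ≤ τ * (π / τ) := by gcongr
      _ = 1 / 2 * (2 * π) := by field_simp
  have hle1 : c * (1 / 2) ^ (2 * κ + 1) * (1 / (2 * π)) ^ 2 * u ^ 2 ≤
      c * ((N : ℝ) ^ (2 * κ + 1) * (τ * u / (2 * π)) ^ 2) := by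
    calc _ = c * ((1 / 2 * M) ^ (2 * κ + 1) * (τ * u / (2 * π)) ^ 2) := by
          rw [Real.mul_rpow (by norm_num) (by positivity)]
          linear_combination (-(c * (1 / 2) ^ (2 * κ + 1) * (1 / (2 * π)) ^ 2 * u ^ 2)) * hMτ
      _ ≤ _ := by gcongr
  have hle2 : (1 / 2) ^ δ * M ^ δ ≤ (N : ℝ) ^ δ := by
    rw [← Real.mul_rpow (by norm_num) (by positivity)]
    gcongr
  have hu2 : 1 + u ^ 2 ≤ 1 + π ^ 2 * M ^ (2 * κ + 1) := by
    have h1 : u ^ 2 ≤ (π / τ) ^ 2 := by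
      rw [← sq_abs]
      gcongr
    have h2 : (π / τ) ^ 2 = π ^ 2 * M ^ (2 * κ + 1) := by
      rw [div_pow, div_eq_iff (by positivity)]
      linear_combination (-π ^ 2) * hMτ
    linarith
  have hexp2 : Real.exp (-((1 / 2) ^ δ * M ^ δ)) ≤ (1 + u ^ 2)⁻¹ := by
    rw [le_inv_comm₀ (by positivity) (by positivity)]
    refine hu2.trans ?_
    rw [← Real.exp_neg, neg_neg]
    rw [Real.exp_neg, mul_inv_le_iff₀ (by positivity), one_mul] at hexp
    exact hexp
  have h1 := norm_tiltChar_le hp.le hNn hNs (τ * u / (2 * π))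
  rw [mul_div_cancel₀ _ (by positivity : 2 * π ≠ 0)] at h1
  refine h1.trans ?_
  have h2 := hmin (τ * u / (2 * π)) hx
  rcases min_le_iff.mp h2 with h3 | h3
  · refine (Real.exp_le_exp.mpr ?_).trans (le_add_of_nonneg_right (by positivity))
    linarith
  · refine le_trans ?_ ((hexp2).trans (le_add_of_nonneg_left (by positivity)))
    exact Real.exp_le_exp.mpr (neg_le_neg (hle2.trans h3))

theorem tendsto_tiltChar (hκ : 1 ≤ κ) (hα : 0 < α) (hA : 0 < A)
    (hL : Tendsto (fun s => logProd κ s - A * s ^ (-α) + c₀) (𝓝[>] 0) (𝓝 0))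
    (hρ : Tendsto ρ atTop (𝓝[>] 0)) (hn : ∀ᶠ n : ℕ in atTop, (n : ℝ) = α * A * ρ n ^ (-(1 + α)))
    (u : ℝ) :
    Tendsto (fun n => tiltChar κ n (ρ n) (ρ n ^ (1 + α / 2) * u)) atTop
      (𝓝 (Real.exp (-(A * (α * (α + 1)) / 2) * u ^ 2) : ℝ)) := by
  obtain ⟨h1, h2⟩ := tendsto_tilt_moments hκ hα hA hL hρ hn
  have h3 := ((tendsto_tiltThird hκ hα hL hρ).const_mul (5 * |u| ^ 3))
  rw [mul_zero] at h3
  have h4 : Tendsto (fun n => tiltChar κ n (ρ n) (ρ n ^ (1 + α / 2) * u) -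
      Complex.exp (((tiltMean κ n (ρ n) - n) * (ρ n ^ (1 + α / 2) * u) : ℝ) * Complex.I) *
      Real.exp (-(tiltVar κ n (ρ n) * (ρ n ^ (1 + α / 2) * u) ^ 2 / 2))) atTop (𝓝 0) := by
    refine squeeze_zero_norm' ?_ h3
    filter_upwards [hρ.eventually self_mem_nhdsWithin] with n hp
    have hp : 0 < ρ n := hp
    refine (norm_tiltChar_sub_le hp.le n _).trans (le_of_eq ?_)
    rw [abs_mul, abs_of_pos (by positivity : 0 < ρ n ^ (1 + α / 2))]
    ring
  have h5 : Tendsto (fun n => Complex.exp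
      (((tiltMean κ n (ρ n) - n) * (ρ n ^ (1 + α / 2) * u) : ℝ) * Complex.I)) atTop (𝓝 1) := by
    have h6 : Tendsto (fun n => (tiltMean κ n (ρ n) - n) * (ρ n ^ (1 + α / 2) * u)) atTop
        (𝓝 0) := by
      have := h1.mul_const u
      rw [zero_mul] at this
      exact this.congr fun n => by ring
    have h7 : Continuous fun t : ℝ => Complex.exp (t * Complex.I) := by fun_prop
    have := (h7.tendsto 0).comp h6
    simpa [Function.comp_def] using this
  have h6 : Tendsto (fun n => ((Real.exp (-(tiltVar κ n (ρ n) *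
      (ρ n ^ (1 + α / 2) * u) ^ 2 / 2)) : ℝ) : ℂ)) atTop
      (𝓝 (Real.exp (-(A * (α * (α + 1)) / 2) * u ^ 2) : ℝ)) := by
    have h7 : Continuous fun t : ℝ => ((Real.exp (-(t / 2) * u ^ 2) : ℝ) : ℂ) := by fun_prop
    refine ((h7.tendsto _).comp h2).congr fun n => ?_
    simp only [Function.comp]
    ring_nf
  have h7 := h4.add (h5.mul h6)
  rw [zero_add, one_mul] at h7
  exact h7.congr fun n => by ring

theorem tendsto_integral_tiltChar (hκ : 1 < κ) (hα : α = 1 / κ) (hA : 0 < A)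
    (hL : Tendsto (fun s => logProd κ s - A * s ^ (-α) + c₀) (𝓝[>] 0) (𝓝 0))
    (hρ : Tendsto ρ atTop (𝓝[>] 0))
    (hn : ∀ᶠ n : ℕ in atTop, (n : ℝ) = α * A * ρ n ^ (-(1 + α))) :
    Tendsto (fun n => ((ρ n ^ (1 + α / 2))⁻¹ : ℝ) * ∫ θ in (-π)..π, tiltChar κ n (ρ n) θ) atTop
      (𝓝 (√(π / (A * (α * (α + 1)) / 2)) : ℝ)) := by
  have hα0 : 0 < α := by rw [hα]; positivity
  have hρpos : ∀ᶠ n in atTop, 0 < ρ n := hρ.eventually self_mem_nhdsWithin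
  obtain ⟨c, hc, hdom⟩ := exists_eventually_norm_tiltChar_le hκ hα hA hρ hn
  have hτ : Tendsto (fun n => π / ρ n ^ (1 + α / 2)) atTop atTop := by
    have := ((tendsto_rpow_neg_nhdsGT_zero (by linarith : -(1 + α / 2) < 0)).comp
      hρ).const_mul_atTop Real.pi_pos
    refine this.congr' ?_
    filter_upwards [hρpos] with n hp
    simp only [Function.comp]
    rw [Real.rpow_neg hp.le, ← div_eq_mul_inv]
  have h1 : Tendsto (fun n => ∫ u : ℝ, (Set.Ioc (-(π / ρ n ^ (1 + α / 2)))
      (π / ρ n ^ (1 + α / 2))).indicator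
      (fun u => tiltChar κ n (ρ n) (ρ n ^ (1 + α / 2) * u)) u) atTop
      (𝓝 (∫ u : ℝ, ((Real.exp (-(A * (α * (α + 1)) / 2) * u ^ 2) : ℝ) : ℂ))) := by
    refine MeasureTheory.tendsto_integral_filter_of_dominated_convergence
      (fun u => Real.exp (-c * u ^ 2) + (1 + u ^ 2)⁻¹) ?_ ?_ ?_ ?_
    · refine Eventually.of_forall fun n => ?_
      refine Measurable.aestronglyMeasurable (Measurable.indicator ?_ measurableSet_Ioc)
      exact ((continuous_tiltChar κ n (ρ n)).comp (continuous_const.mul continuous_id)).measurable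
    · filter_upwards [hdom] with n hdom
      refine Eventually.of_forall fun u => ?_
      by_cases hu : u ∈ Set.Ioc (-(π / ρ n ^ (1 + α / 2))) (π / ρ n ^ (1 + α / 2))
      · rw [Set.indicator_of_mem hu]
        exact hdom u (abs_le.mpr ⟨hu.1.le, hu.2⟩)
      · rw [Set.indicator_of_notMem hu, norm_zero]
        positivity
    · exact (integrable_exp_neg_mul_sq hc).add integrable_inv_one_add_sq
    · refine Eventually.of_forall fun u => ?_
      refine (tendsto_tiltChar hκ.le hα0 hA hL hρ hn u).congr' ?_
      filter_upwards [hτ.eventually_gt_atTop |u|] with n hu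
      rw [Set.indicator_of_mem]
      exact ⟨(abs_lt.mp hu).1, (abs_lt.mp hu).2.le⟩
  rw [integral_complex_ofReal, integral_gaussian] at h1
  refine h1.congr' ?_
  filter_upwards [hρpos] with n hp
  have hτ0 : 0 < ρ n ^ (1 + α / 2) := by positivity
  have hle : -(π / ρ n ^ (1 + α / 2)) ≤ π / ρ n ^ (1 + α / 2) :=
    neg_le_self (by positivity)
  rw [MeasureTheory.integral_indicator measurableSet_Ioc,
    ← intervalIntegral.integral_of_le hle,
    intervalIntegral.integral_comp_mul_left _ hτ0.ne', mul_neg, mul_div_cancel₀ _ hτ0.ne',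
    Complex.real_smul]

end Saddle

theorem realZeta_pos {x : ℝ} (hx : 1 < x) : 0 < realZeta x := by
  have h := hasSum_realZeta hx
  rw [← h.tsum_eq]
  exact h.summable.tsum_pos (fun _ => by positivity) 0 (by positivity)

theorem saddle_term_eq {κ α A B x : ℝ} (hα0 : 0 < α) (hακ : α * κ = 1) (hB : 0 < B)
    (hAB : B = α * A) (hx : 0 < x) :
    B ^ (1 / (2 * (1 + α))) / (2 * √(π * (1 + α))) * x ^ (-((α + 2) / (2 * (1 + α)))) *
      Real.exp ((1 + κ) * B ^ (1 / (1 + α)) * x ^ (1 / (1 + κ))) =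
    Real.exp ((B / x) ^ (1 / (1 + α)) * x + A * ((B / x) ^ (1 / (1 + α))) ^ (-α) - Real.log 2 / 2) /
      (2 * π) * ((B / x) ^ (1 / (1 + α))) ^ (1 + α / 2) * √(π / (A * (α * (α + 1)) / 2)) := by
  have hκ0 : 0 < κ := by
    by_contra! h
    nlinarith
  have hρ : (B / x) ^ (1 / (1 + α)) = B ^ (1 / (1 + α)) * x ^ (-(1 / (1 + α))) := by
    rw [Real.div_rpow hB.le hx.le, Real.rpow_neg hx.le, div_eq_mul_inv]
  have h1 : (B / x) ^ (1 / (1 + α)) * x = B ^ (1 / (1 + α)) * x ^ (1 / (1 + κ)) := by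
    rw [hρ, mul_assoc]
    congr 1
    nth_rewrite 2 [← Real.rpow_one x]
    rw [← Real.rpow_add hx]
    congr 1
    field_simp
    linear_combination hακ
  have h2 : A * ((B / x) ^ (1 / (1 + α))) ^ (-α) = κ * ((B / x) ^ (1 / (1 + α)) * x) := by
    have h3 : ((B / x) ^ (1 / (1 + α))) ^ (-α) = (B / x) ^ (1 / (1 + α)) * (B / x)⁻¹ := by
      rw [← Real.rpow_mul (by positivity), ← Real.rpow_neg_one (B / x),
        ← Real.rpow_add (by positivity)]
      congr 1
      field_simp
      ring
    rw [h3, show A = κ * B by rw [hAB]; linear_combination (-A) * hακ]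
    field_simp
  have h3 : ((B / x) ^ (1 / (1 + α))) ^ (1 + α / 2) =
      √B * B ^ (1 / (2 * (1 + α))) * x ^ (-((α + 2) / (2 * (1 + α)))) := by
    rw [hρ, Real.mul_rpow (by positivity) (by positivity), ← Real.rpow_mul hB.le,
      ← Real.rpow_mul hx.le, Real.sqrt_eq_rpow, ← Real.rpow_add hB]
    congr 2
    · field_simp
      ring
    · field_simp
      ring
  have h4 : Real.exp (-(Real.log 2 / 2)) = (√2)⁻¹ := by
    rw [Real.exp_neg, Real.sqrt_eq_rpow, Real.rpow_def_of_pos (by norm_num)]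
    ring_nf
  have h5 : √(π / (A * (α * (α + 1)) / 2)) = √2 * √π / (√B * √(1 + α)) := by
    rw [← Real.sqrt_mul (by norm_num), ← Real.sqrt_mul hB.le, ← Real.sqrt_div (by positivity), hAB]
    congr 1
    have hA : A ≠ 0 := by rintro rfl; simp at hAB; linarith
    field_simp
    ring
  have h6 : √π ^ 2 = π := Real.sq_sqrt Real.pi_pos.le
  rw [h2, h1, h3, h5, sub_eq_add_neg, Real.exp_add, h4, Real.sqrt_mul Real.pi_pos.le]
  have h7 : B ^ (1 / (1 + α)) * x ^ (1 / (1 + κ)) + κ * (B ^ (1 / (1 + α)) * x ^ (1 / (1 + κ))) =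
      (1 + κ) * B ^ (1 / (1 + α)) * x ^ (1 / (1 + κ)) := by ring
  rw [h7]
  have : 0 < √π := by positivity
  have : 0 < √B := by positivity
  field_simp
  linear_combination -h6

theorem tendsto_qk_div_saddle {κ α A B c₀ : ℝ} (hκ : 1 < κ) (hα : α = 1 / κ) (hB : 0 < B)
    (hAB : B = α * A)
    (hL : Tendsto (fun s => logProd κ s - A * s ^ (-α) + c₀) (𝓝[>] 0) (𝓝 0)) :
    Tendsto (fun n : ℕ => (qk κ n : ℝ) /
      (Real.exp ((B / n) ^ (1 / (1 + α)) * n + A * ((B / n) ^ (1 / (1 + α))) ^ (-α) - c₀) /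
        (2 * π) * ((B / n) ^ (1 / (1 + α))) ^ (1 + α / 2) * √(π / (A * (α * (α + 1)) / 2))))
      atTop (𝓝 1) := by
  have hα0 : 0 < α := by rw [hα]; positivity
  have hA : 0 < A := by
    by_contra! h
    nlinarith
  set ρ : ℕ → ℝ := fun n => (B / n) ^ (1 / (1 + α)) with hρdef
  have hpos : ∀ᶠ n : ℕ in atTop, 0 < ρ n := by
    filter_upwards [eventually_gt_atTop 0] with n hn
    have : (0 : ℝ) < n := by exact_mod_cast hn
    simp only [hρdef]
    positivity
  have hρ : Tendsto ρ atTop (𝓝[>] 0) := by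
    refine tendsto_nhdsWithin_iff.mpr ⟨?_, hpos⟩
    have h1 := (tendsto_const_div_atTop_nhds_zero_nat B).rpow_const
      (p := 1 / (1 + α)) (Or.inr (by positivity))
    rwa [Real.zero_rpow (by positivity)] at h1
  have hn : ∀ᶠ n : ℕ in atTop, (n : ℝ) = α * A * ρ n ^ (-(1 + α)) := by
    filter_upwards [eventually_gt_atTop 0] with n hn
    have hn : (0 : ℝ) < n := by exact_mod_cast hn
    simp only [hρdef]
    rw [← Real.rpow_mul (by positivity), ← hAB,
      show 1 / (1 + α) * -(1 + α) = -1 by field_simp, Real.rpow_neg_one]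
    field_simp
  have h1 := tendsto_integral_tiltChar hκ hα hA hL hρ hn
  have h2 := tendsto_logProdTrunc_sub hκ.le hα0 hA hL hρ hn hρ
    (hpos.mono fun n h => by linarith)
  have h3 := (Complex.continuous_re.tendsto _).comp h1
  have h4 := (Real.continuous_exp.tendsto _).comp h2
  have hS : 0 < √(π / (A * (α * (α + 1)) / 2)) := by positivity
  have h5 := (h4.mul h3).div_const √(π / (A * (α * (α + 1)) / 2))
  rw [Complex.ofReal_re, Real.exp_zero, one_mul, div_self hS.ne'] at h5
  refine h5.congr' ?_
  filter_upwards [hpos] with n hp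
  change Real.exp _ * (_ : ℂ).re / _ = (qk κ n : ℝ) / (Real.exp (ρ n * n + A * ρ n ^ (-α) - c₀) /
    (2 * π) * ρ n ^ (1 + α / 2) * _)
  have h6 : (qk κ n : ℝ) = Real.exp (ρ n * n + logProdTrunc κ n (ρ n)) / (2 * π) *
      (∫ θ in (-π)..π, tiltChar κ n (ρ n) θ).re := by
    have := congrArg Complex.re (qk_eq_integral_tiltChar hκ.le n (ρ n))
    rwa [Complex.re_ofReal_mul, Complex.natCast_re] at this
  have h7 : Real.exp (ρ n * n + logProdTrunc κ n (ρ n)) =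
      Real.exp (ρ n * n + A * ρ n ^ (-α) - c₀) *
        Real.exp (logProdTrunc κ n (ρ n) - A * ρ n ^ (-α) + c₀) := by
    rw [← Real.exp_add]; ring_nf
  rw [h6, h7, Complex.re_ofReal_mul]
  have hτ : 0 < ρ n ^ (1 + α / 2) := by positivity
  generalize ρ n ^ (1 + α / 2) = τ at hτ ⊢
  field_simp

theorem stmt3 (κ : ℝ) (hκ : 1 < κ) (α β c : ℝ) (hα : α = 1 / κ)
    (hβ : β = α * Real.Gamma (α + 1) * realZeta (α + 1))
    (hc : c = ((1 - 2 ^ (-α)) * β) ^ (1 / (2 * (1 + α))) / (2 * Real.sqrt (π * (1 + α)))) :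
    Tendsto (fun n : ℕ => (qk κ n : ℝ) /
        (c * (n : ℝ) ^ (-((α + 2) / (2 * (1 + α)))) *
          Real.exp ((1 + κ) * ((1 - 2 ^ (-α)) * β) ^ (1 / (1 + α)) * (n : ℝ) ^ (1 / (1 + κ)))))
      atTop (𝓝 1) := by
  have hα0 : 0 < α := by rw [hα]; positivity
  have hακ : α * κ = 1 := by rw [hα]; field_simp
  have hL := tendsto_logProd_sub hκ
  rw [← hα] at hL
  have hE : 0 < 1 - (2 : ℝ) ^ (-α) :=
    sub_pos.mpr (Real.rpow_lt_one_of_one_lt_of_neg (by norm_num) (by linarith))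
  have hζ := realZeta_pos (x := α + 1) (by linarith)
  have hΓ := Real.Gamma_pos_of_pos (by linarith : 0 < α + 1)
  have hB : 0 < (1 - (2 : ℝ) ^ (-α)) * β := by rw [hβ]; positivity
  have hAB : (1 - (2 : ℝ) ^ (-α)) * β =
      α * (Gamma (α + 1) * ((1 - 2 ^ (-α)) * realZeta (α + 1))) := by rw [hβ]; ring
  refine (tendsto_qk_div_saddle hκ hα hB hAB hL).congr' ?_
  filter_upwards [eventually_gt_atTop 0] with n hn
  rw [hc, saddle_term_eq hα0 hακ hB hAB (by exact_mod_cast hn)]
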